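/- Let S be a countable set, let s_0 ∈ S, and let M : S × S → ℕ ∪ {∞} be a function. Then there is at most one probability measure μ on S^ℕ such that μ is partially exchangeable, μ-almost every sequence visits each state of S only finitely often (transience), μ(X_0 = s_0) = 1, and μ-almost surely #{i ≥ 0 : (X_i, X_{i+1}) = (u,v)} = M(u,v) for every u,v ∈ S. -/

import Mathlib

open MeasureTheory Filter Set
open scoped ENNReal

namespace DF

/-! ### Sequences over a countable state space -/

variable {S : Type}

/-- The number of transitions from `u` to `v` among the first `n` steps of the sequence `x`. -/
noncomputable def transCount (x : ℕ → S) (n : ℕ) (u v : S) : ℕ :=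
  Set.ncard {i : ℕ | i < n ∧ x i = u ∧ x (i + 1) = v}

/-- The equivalence `(x₀,…,xₙ) ≃ (y₀,…,yₙ)` of finite sequences: same initial state and the same
transition counts between every ordered pair of states. -/
def FinEquiv (x y : ℕ → S) (n : ℕ) : Prop :=
  x 0 = y 0 ∧ ∀ u v : S, transCount x n u v = transCount y n u v

/-- The equivalence `x ≃ y` of infinite sequences: they eventually agree and their initial
segments up to that point are `≃`-equivalent. -/
def InfEquiv (x y : ℕ → S) : Prop :=
  ∃ N : ℕ, (∀ n : ℕ, N ≤ n → x n = y n) ∧ FinEquiv x y N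

/-- The transition numbers `M(u,v) = #{i ≥ 0 : (xᵢ, xᵢ₊₁) = (u,v)}` of an infinite sequence. -/
noncomputable def transNum (x : ℕ → S) (u v : S) : ℕ∞ :=
  Set.encard {i : ℕ | x i = u ∧ x (i + 1) = v}

/-- The sigma-algebra on `S^ℕ` generated by the transition numbers. -/
noncomputable def transSigma (S : Type) : MeasurableSpace (ℕ → S) :=
  ⨆ u : S, ⨆ v : S, MeasurableSpace.comap (fun x => transNum x u v) (⊤ : MeasurableSpace ℕ∞)

/-- The tail sigma-algebra `⋂ₙ σ(Xₙ, Xₙ₊₁, …)` on `S^ℕ`. -/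
def tailSigma (S : Type) [MeasurableSpace S] : MeasurableSpace (ℕ → S) :=
  ⨅ n : ℕ, MeasurableSpace.comap (fun (x : ℕ → S) (i : ℕ) => x (i + n))
    (inferInstance : MeasurableSpace (ℕ → S))

/-- A measure on `S^ℕ` is partially exchangeable if any two `≃`-equivalent finite initial
segments have the same probability. -/
def PartiallyExchangeable [MeasurableSpace S] (μ : Measure (ℕ → S)) : Prop :=
  ∀ (n : ℕ) (x y : ℕ → S), FinEquiv x y n →
    μ {ω | ∀ i ≤ n, ω i = x i} = μ {ω | ∀ i ≤ n, ω i = y i}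

/-- The set of partially exchangeable probability measures on `S^ℕ`. -/
def PEProb (S : Type) [MeasurableSpace S] : Set (Measure (ℕ → S)) :=
  {μ | μ Set.univ = 1 ∧ PartiallyExchangeable μ}

/-- `μ` is an extreme point of the convex set of partially exchangeable probability measures. -/
def IsExtremePE [MeasurableSpace S] (μ : Measure (ℕ → S)) : Prop :=
  μ ∈ PEProb S ∧
    ∀ μ₁ ∈ PEProb S, ∀ μ₂ ∈ PEProb S, ∀ t : ℝ≥0∞, 0 < t → t < 1 →
      μ = t • μ₁ + (1 - t) • μ₂ → μ₁ = μ₂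

/-! ### Digraphs -/

/-- A digraph on vertex set `V` with edge set `E`: each edge has a tail (`src`) and head (`dst`).
Multiple edges and loops are allowed. -/
structure DigraphStruct (V E : Type) where
  src : E → V
  dst : E → V

namespace DigraphStruct

variable {V E : Type} (G : DigraphStruct V E)

def outEdges (v : V) : Set E := {e | G.src e = v}

def inEdges (v : V) : Set E := {e | G.dst e = v}

noncomputable def outDeg (v : V) : ℕ := (G.outEdges v).ncard

noncomputable def inDeg (v : V) : ℕ := (G.inEdges v).ncard

def LocallyFinite : Prop := ∀ v : V, (G.outEdges v).Finite ∧ (G.inEdges v).Finite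

/-- Adjacency in the underlying undirected graph. -/
def undirAdj (u v : V) : Prop :=
  ∃ e : E, (G.src e = u ∧ G.dst e = v) ∨ (G.src e = v ∧ G.dst e = u)

/-- `G` is connected as an undirected graph. -/
def Connected : Prop := ∀ u v : V, Relation.ReflTransGen G.undirAdj u v

def dirAdj (u v : V) : Prop := ∃ e : E, G.src e = u ∧ G.dst e = v

/-- One step along an edge of the edge set `B`. -/
def step (B : Set E) (u v : V) : Prop := ∃ e ∈ B, G.src e = u ∧ G.dst e = v

/-- `(G,o)` is an infinite sourced Eulerian digraph (with sink at infinity). -/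
structure IsSourcedEulerian (o : V) : Prop where
  infinite : Infinite V
  locFin : G.LocallyFinite
  conn : G.Connected
  balanced : ∀ v : V, v ≠ o → G.inDeg v = G.outDeg v
  source : G.outDeg o = G.inDeg o + 1

/-- The reversal of `G`: head and tail of every edge are exchanged. -/
def rev : DigraphStruct V E := ⟨G.dst, G.src⟩

/-- One-step transition probability of the random walk on `G`. -/
noncomputable def stepProb (u v : V) : ℝ≥0∞ :=
  ({e : E | G.src e = u ∧ G.dst e = v}.ncard : ℝ≥0∞) / (G.outDeg u : ℝ≥0∞)

open Classical in
/-- `μ` is the law of the random walk on `G` started at `o`, characterised through its cylinder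
probabilities. -/
def IsWalkLaw [MeasurableSpace V] (o : V) (μ : Measure (ℕ → V)) : Prop :=
  μ Set.univ = 1 ∧
    ∀ (n : ℕ) (x : ℕ → V),
      μ {ω | ∀ i ≤ n, ω i = x i} =
        if x 0 = o then ∏ i ∈ Finset.range n, G.stepProb (x i) (x (i + 1)) else 0

/-- `G` is transient: from every starting point, the random walk on `G` visits every vertex at
most finitely often almost surely. -/
def TransientDigraph [MeasurableSpace V] : Prop :=
  ∀ (o : V) (μ : Measure (ℕ → V)),
    G.IsWalkLaw o μ → μ {ω | ∀ v : V, {i : ℕ | ω i = v}.Finite} = 1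

/-- An infinite path in `G` indexed by `ℕ`, encoded by its sequence of edges. -/
def IsInfPath (γ : ℕ → E) : Prop := ∀ i : ℕ, G.dst (γ i) = G.src (γ (i + 1))

/-- A transient path: it visits every vertex at most finitely often. -/
def IsTransientPath (γ : ℕ → E) : Prop := ∀ v : V, {i : ℕ | G.src (γ i) = v}.Finite

/-- The edge set of the last-exit arboretum `𝓛(γ)`: the edges crossed by `γ` as it exits their
tail for the last time. -/
def lastExitSet (γ : ℕ → E) : Set E :=
  {e | ∃ i : ℕ, γ i = e ∧ ∀ j : ℕ, i < j → G.src (γ j) ≠ G.src (γ i)}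

end DigraphStruct

/-! ### Finite paths, Eulerian paths, arborescences -/

/-- `IsPathList G o z P` means that the list of edges `P` forms a directed path from `o`
to `z` in `G`. -/
def IsPathList {V E : Type} (G : DigraphStruct V E) : V → V → List E → Prop
  | o, z, [] => o = z
  | o, z, e :: es => G.src e = o ∧ IsPathList G (G.dst e) z es

/-- `P` is an Eulerian path from `o` to `z`: a path crossing every edge exactly once. -/
def IsEulerList {V E : Type} (G : DigraphStruct V E) (o z : V) (P : List E) : Prop :=
  IsPathList G o z P ∧ P.Nodup ∧ ∀ e : E, e ∈ P

/-- `B` is (the edge set of) a spanning in-arborescence of `G` rooted at `z`. -/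
def IsFinArb {V E : Type} (G : DigraphStruct V E) (z : V) (B : Set E) : Prop :=
  (∀ e ∈ B, G.src e ≠ z) ∧
  (∀ v : V, v ≠ z → ∃! e : E, e ∈ B ∧ G.src e = v) ∧
  (∀ v : V, Relation.ReflTransGen (G.step B) v z)

/-- `(G,o,z)` is a finite Eulerian digraph with source `o` and sink `z`. -/
structure IsFinEulerian {V E : Type} (G : DigraphStruct V E) (o z : V) : Prop where
  finV : Finite V
  finE : Finite E
  reach_from : ∀ v : V, Relation.ReflTransGen G.dirAdj o v
  reach_to : ∀ v : V, Relation.ReflTransGen G.dirAdj v z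
  bal_ne : o ≠ z → (∀ v : V, v ≠ o → v ≠ z → G.inDeg v = G.outDeg v) ∧
      G.outDeg o = G.inDeg o + 1 ∧ G.inDeg z = G.outDeg z + 1
  bal_eq : o = z → ∀ v : V, G.inDeg v = G.outDeg v

/-! ### Wired uniform spanning in-arborescences -/

/-- An exhaustion of the vertex set by finite subsets. -/
def IsExhaustion {V : Type} (Vn : ℕ → Set V) : Prop :=
  (∀ n, (Vn n).Finite) ∧ (∀ n, Vn n ⊆ Vn (n + 1)) ∧ (⋃ n, Vn n) = Set.univ

/-- `B` is (the edge set of) a spanning in-arborescence of the wired graph `G_U^*`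
(all vertices outside `U` identified to a single boundary vertex) rooted at the boundary. -/
def IsWiredArb {V E : Type} (G : DigraphStruct V E) (U : Set V) (B : Set E) : Prop :=
  (∀ e ∈ B, G.src e ∈ U) ∧ (∀ v ∈ U, ∃! e : E, e ∈ B ∧ G.src e = v) ∧
  (∀ v ∈ U, ∃ v' : V, v' ∉ U ∧ Relation.ReflTransGen (G.step B) v v')

/-- The probability, under the uniform spanning in-arborescence of the wired graph `G_U^*`
rooted at the boundary, that all edges of `F` are present. -/
noncomputable def wiredUACyl {V E : Type} (G : DigraphStruct V E) (U : Set V) (F : Finset E) :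
    ℝ≥0∞ :=
  (Nat.card {B : Set E // IsWiredArb G U B ∧ (F : Set E) ⊆ B} : ℝ≥0∞) /
    (Nat.card {B : Set E // IsWiredArb G U B} : ℝ≥0∞)

/-- `κ` is the law of the wired uniform spanning in-arboretum of `G` (as a random edge set,
encoded as an element of `E → Bool`): its cylinder probabilities are the limits along any
exhaustion of the uniform spanning in-arborescence measures of the wired graphs. -/
def IsWUALaw {V E : Type} (G : DigraphStruct V E) (κ : Measure (E → Bool)) : Prop :=
  κ Set.univ = 1 ∧
    ∀ Vn : ℕ → Set V, IsExhaustion Vn → ∀ F : Finset E,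
      Filter.Tendsto (fun n => wiredUACyl G (Vn n) F) Filter.atTop
        (nhds (κ {A | ∀ e ∈ F, A e = true}))

/-- A spanning in-arboretum rooted at infinity all of whose components are one-ended:
every vertex has out-degree exactly one, and the past of every vertex is finite. -/
def IsOneEndedSpanningArb {V E : Type} (G : DigraphStruct V E) (A : Set E) : Prop :=
  (∀ v : V, ∃! e : E, e ∈ A ∧ G.src e = v) ∧
    ∀ v : V, {u : V | Relation.ReflTransGen (G.step A) u v}.Finite

/-! ### Proper Gibbs measures on Eulerian paths -/

/-- `w` is a finite path in `G` starting at `o` (encoded by its edges). -/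
def PrefixPath {V E : Type} (G : DigraphStruct V E) (o : V) {n : ℕ} (w : Fin n → E) : Prop :=
  (∀ h : 0 < n, G.src (w ⟨0, h⟩) = o) ∧
    ∀ (i : ℕ) (h : i + 1 < n), G.dst (w ⟨i, Nat.lt_of_succ_lt h⟩) = G.src (w ⟨i + 1, h⟩)

/-- A proper Gibbs measure on Eulerian paths from `o` to `∞` in `G`: a probability measure on
edge sequences, supported on half-infinite paths started at `o` crossing every edge exactly once,
such that conditionally on the steps after time `n` the first `n` steps are a uniform Eulerian
path (from `o`, in the digraph spanned by the edges not crossed after time `n`, to the position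
at time `n`). Uniformity is expressed by invariance under replacing the first `n` steps by any
other path from `o` crossing the same set of edges. -/
def ProperGibbs {V E : Type} [MeasurableSpace E] (G : DigraphStruct V E) (o : V)
    (μ : Measure (ℕ → E)) : Prop :=
  μ Set.univ = 1 ∧
  μ {γ | (∀ i : ℕ, G.dst (γ i) = G.src (γ (i + 1))) ∧ G.src (γ 0) = o ∧ Function.Bijective γ}
      = 1 ∧
  ∀ (n : ℕ) (w w' : Fin n → E), Function.Injective w → Function.Injective w' →
    Set.range w = Set.range w' → PrefixPath G o w → PrefixPath G o w' →
    ∀ B : Set (ℕ → E),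
      μ {γ | (∀ i : Fin n, γ (i : ℕ) = w i) ∧ (fun t : ℕ => γ (n + t)) ∈ B} =
        μ {γ | (∀ i : Fin n, γ (i : ℕ) = w' i) ∧ (fun t : ℕ => γ (n + t)) ∈ B}

/-! ### Loop erasure and Wilson's algorithm rooted at infinity -/

/-- The loop-erasure times of the (transient) vertex sequence `p`:
`t₀ = 0`, `tᵢ₊₁ = 1 + max {t ≥ tᵢ : p t = p tᵢ}`. -/
noncomputable def leTimes {V : Type} (p : ℕ → V) : ℕ → ℕ
  | 0 => 0
  | i + 1 => sSup {t : ℕ | leTimes p i ≤ t ∧ p t = p (leTimes p i)} + 1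

/-- The loop-erasure times of the vertex sequence `p` run up to time `k`. -/
noncomputable def leTimesF {V : Type} (p : ℕ → V) (k : ℕ) : ℕ → ℕ
  | 0 => 0
  | i + 1 => sSup {t : ℕ | leTimesF p k i ≤ t ∧ t ≤ k ∧ p t = p (leTimesF p k i)} + 1

/-- The set of vertices incident to an edge of `A`. -/
def vertsOf {V E : Type} (G : DigraphStruct V E) (A : Set E) : Set V :=
  {u | ∃ e ∈ A, G.src e = u ∨ G.dst e = u}

open Classical in
/-- The set of edges of the loop-erasure of the walk `x` (an edge sequence) stopped when it
first hits `U`; if it never hits `U`, the loop-erasure of the whole (transient) walk. -/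
noncomputable def stoppedLEedges {V E : Type} (G : DigraphStruct V E) (U : Set V) (x : ℕ → E) :
    Set E :=
  if ∃ t : ℕ, G.src (x t) ∈ U then
    {e | ∃ i : ℕ,
      leTimesF (fun t => G.src (x t)) (sInf {t : ℕ | G.src (x t) ∈ U}) i <
          sInf {t : ℕ | G.src (x t) ∈ U} ∧
        x (leTimesF (fun t => G.src (x t)) (sInf {t : ℕ | G.src (x t) ∈ U}) i) = e}
  else Set.range fun i => x (leTimes (fun t => G.src (x t)) i)

/-- The partial edge sets generated by Wilson's algorithm rooted at infinity, run with the
enumeration `v` of the vertices and with `W j` the random walk used at stage `j + 1`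
(started at `v j`). -/
noncomputable def wilsonA {V E : Type} (G : DigraphStruct V E) (v : ℕ → V) (W : ℕ → ℕ → E) :
    ℕ → Set E
  | 0 => ∅
  | j + 1 =>
      wilsonA G v W j ∪
        stoppedLEedges G (vertsOf G (wilsonA G v W j) ∪ {u | ∃ i < j, v i = u}) (W j)

open Classical in
/-- Cylinder probabilities for the random walk on `G` started at `v`, recorded as a sequence of
edges: the probability that the first `n` crossed edges are `x 0, …, x (n-1)`. -/
noncomputable def edgeWalkCyl {V E : Type} (G : DigraphStruct V E) (v : V) (x : ℕ → E) (n : ℕ) :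
    ℝ≥0∞ :=
  if (0 < n → G.src (x 0) = v) ∧ (∀ i : ℕ, i + 1 < n → G.dst (x i) = G.src (x (i + 1))) then
    ∏ i ∈ Finset.range n, ((G.outDeg (G.src (x i)) : ℝ≥0∞))⁻¹
  else 0

/-- `P` is the joint law of a sequence of independent random walks on `G`, the `j`-th walk
started at `v j`. -/
def IsIndepWalksLaw {V E : Type} [MeasurableSpace E] (G : DigraphStruct V E) (v : ℕ → V)
    (P : Measure (ℕ → ℕ → E)) : Prop :=
  P Set.univ = 1 ∧
    ∀ (m n : ℕ) (x : ℕ → ℕ → E),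
      P {ω | ∀ j < m, ∀ t < n, ω j t = x j t} =
        ∏ j ∈ Finset.range m, edgeWalkCyl G (v j) (x j) n

/-- `μ` is the law of the random walk on `G` started at `o`, recorded as its sequence of crossed
edges. -/
def IsEdgeWalkLaw {V E : Type} [MeasurableSpace E] (G : DigraphStruct V E) (o : V)
    (μ : Measure (ℕ → E)) : Prop :=
  μ Set.univ = 1 ∧ ∀ (n : ℕ) (x : ℕ → E), μ {ω | ∀ i < n, ω i = x i} = edgeWalkCyl G o x n

/-! ### Finite approximations and Gibbs measures on arboreta -/

/-- A finite digraph with vertices and edges labelled by natural numbers. -/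
structure FinDigraph where
  VS : Finset ℕ
  ES : Finset ℕ
  fsrc : ℕ → ℕ
  fdst : ℕ → ℕ

/-- `B` is a spanning in-arborescence of the finite digraph `H` rooted at `z`. -/
def FinDigraph.IsArb (H : FinDigraph) (z : ℕ) (B : Finset ℕ) : Prop :=
  B ⊆ H.ES ∧ (∀ e ∈ B, H.fsrc e ≠ z) ∧
  (∀ v ∈ H.VS, v ≠ z → ∃! e : ℕ, e ∈ B ∧ H.fsrc e = v) ∧
  (∀ v ∈ H.VS, Relation.ReflTransGen
      (fun a b => ∃ e ∈ B, H.fsrc e = a ∧ H.fdst e = b) v z)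

/-- A finite digraph `H` with a distinguished vertex `z`, together with a partial isomorphism
to a digraph on `(V, E)`: vertex and edge domains `A`, `F` in `H` and maps `φV`, `φE` to `V`, `E`. -/
structure PIso (V E : Type) where
  H : FinDigraph
  z : ℕ
  A : Finset ℕ
  F : Finset ℕ
  φV : ℕ → V
  φE : ℕ → E

/-- The data of `p` really is a partial isomorphism to `G`. -/
def PIso.Valid {V E : Type} (p : PIso V E) (G : DigraphStruct V E) : Prop :=
  ↑p.A ⊆ ↑p.H.VS ∧ ↑p.F ⊆ ↑p.H.ES ∧ p.z ∈ p.H.VS ∧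
  Set.InjOn p.φV ↑p.A ∧ Set.InjOn p.φE ↑p.F ∧
  ∀ e ∈ p.F, p.H.fsrc e ∈ p.A ∧ p.H.fdst e ∈ p.A ∧
    G.src (p.φE e) = p.φV (p.H.fsrc e) ∧ G.dst (p.φE e) = p.φV (p.H.fdst e)

/-- The partial isomorphism `p` identifies a neighbourhood of (a preimage of) `w`:
`w` is in the range of `φV` and `φE` maps the edges incident to its preimage bijectively onto
the edges incident to `w`. -/
def PIso.GoodAt {V E : Type} (p : PIso V E) (G : DigraphStruct V E) (w : V) : Prop :=
  ∃ w' ∈ p.A, p.φV w' = w ∧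
    (∀ e' ∈ p.H.ES, (p.H.fsrc e' = w' ∨ p.H.fdst e' = w') → e' ∈ p.F) ∧
    ∀ e : E, (G.src e = w ∨ G.dst e = w) →
      ∃! e' : ℕ, e' ∈ p.F ∧ (p.H.fsrc e' = w' ∨ p.H.fdst e' = w') ∧ p.φE e' = e

/-- `a` is a finite approximation to `G`: a sequence of finite digraphs with distinguished
vertices `zₙ` and partial isomorphisms to `G`, identifying larger and larger neighbourhoods of
every finite vertex set, with the distinguished vertices escaping to infinity. -/
def IsFinApproxSeq {V E : Type} (G : DigraphStruct V E) (a : ℕ → PIso V E) : Prop :=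
  (∀ n, (a n).Valid G) ∧
  (∀ W : Finset V, ∃ N, ∀ n ≥ N, ∀ w ∈ W, (a n).GoodAt G w) ∧
  (∀ W : Finset V, ∃ N, ∀ n ≥ N, ¬((a n).z ∈ (a n).A ∧ (a n).φV (a n).z ∈ (W : Set V)))

/-- The probability, under the uniform spanning in-arborescence of `p.H` rooted at `p.z`, that
every edge of `F` is in the image of the arborescence under the partial isomorphism. -/
noncomputable def pisoUACyl {V E : Type} (p : PIso V E) (F : Finset E) :
    ℝ≥0∞ :=
  (Nat.card {B : Finset ℕ // p.H.IsArb p.z B ∧ ∀ e ∈ F, ∃ e' ∈ B, e' ∈ p.F ∧ p.φE e' = e} :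
      ℝ≥0∞) /
    (Nat.card {B : Finset ℕ // p.H.IsArb p.z B} : ℝ≥0∞)

/-- `μ` (a measure on edge sets, encoded as elements of `E → Bool`) is a Gibbs measure on
spanning in-arboreta of `G` rooted at infinity: it is a weak limit of mixtures (over a random
finite approximation to `G`) of uniform spanning in-arborescence measures on finite
approximations to `G`. -/
def IsArbGibbs {V E : Type} (G : DigraphStruct V E) (μ : Measure (E → Bool)) : Prop :=
  μ Set.univ = 1 ∧
  ∃ (Ω : Type) (mΩ : MeasurableSpace Ω) (ν : @Measure Ω mΩ) (a : Ω → ℕ → PIso V E),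
    ν Set.univ = 1 ∧ (∀ ω : Ω, IsFinApproxSeq G (a ω)) ∧
    ∀ F : Finset E,
      Filter.Tendsto (fun n => ∫⁻ ω, pisoUACyl (a ω n) F ∂ν) Filter.atTop
        (nhds (μ {A : E → Bool | ∀ e ∈ F, A e = true}))

/-! ### Stacks -/

open Classical in
/-- The state (current vertex, remaining stacks) after `n` steps of following the stacks `σ`
starting from `o`: at each step we cross the edge at the front of the list at the current vertex
and delete it from the list (doing nothing if the list is empty). -/
noncomputable def stackState {V E : Type} (G : DigraphStruct V E) (o : V) (σ : V → List E) :
    ℕ → V × (V → List E)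
  | 0 => (o, σ)
  | n + 1 =>
    let p := stackState G o σ n
    match p.2 p.1 with
    | [] => p
    | e :: rest => (G.dst e, Function.update p.2 p.1 rest)

/-- The edge crossed at step `n` when following the stacks `σ` from `o` (`none` if the
current stack is exhausted). -/
noncomputable def stackEdge {V E : Type} (G : DigraphStruct V E) (o : V) (σ : V → List E)
    (n : ℕ) : Option E :=
  ((stackState G o σ n).2 (stackState G o σ n).1).head?

/-- The sigma-algebra on stack configurations. -/
noncomputable def stackMS (V E : Type) : MeasurableSpace (V → List E) :=
  @MeasurableSpace.pi V (fun _ => List E) fun _ => ⊤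

open Classical in
/-- `ρ` is the law of the random stack configuration built from a random arboretum with law `κ`:
place the arboretum edge at the bottom of the stack at each vertex, and an independent,
uniformly random ordering of the remaining outgoing edges on top of it. -/
def IsStackLaw {V E : Type} (G : DigraphStruct V E) (κ : Measure (E → Bool))
    (ρ : @Measure (V → List E) (stackMS V E)) : Prop :=
  ρ Set.univ = 1 ∧
    ∀ (K : Finset V) (s : V → List E),
      ρ {σ | ∀ v ∈ K, σ v = s v} =
        if ∀ v ∈ K, (s v).Nodup ∧ ∀ e : E, e ∈ s v ↔ G.src e = v then
          κ {A | ∀ v ∈ K, ∃ e : E, (s v).getLast? = some e ∧ A e = true} *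
            ∏ v ∈ K, (((G.outDeg v - 1).factorial : ℝ≥0∞))⁻¹
        else 0

/-! ### Markov chains -/

open Classical in
/-- `ν` is the law of the trajectory of a Markov chain with state space `S' ⊆ S`, transition
kernel `p` and deterministic initial state `s0`. -/
def IsMCLaw {S : Type} [MeasurableSpace S] (S' : Set S) (p : S → S → ℝ≥0∞) (s0 : S)
    (ν : Measure (ℕ → S)) : Prop :=
  ν Set.univ = 1 ∧ s0 ∈ S' ∧
  (∀ u ∈ S', (∑' v : S, p u v) = 1 ∧ ∀ v : S, p u v ≠ 0 → v ∈ S') ∧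
  (∀ u : S, u ∉ S' → ∀ v : S, p u v = 0) ∧
  ∀ (n : ℕ) (y : ℕ → S),
    ν {x | ∀ i ≤ n, x i = y i} =
      if y 0 = s0 then ∏ i ∈ Finset.range n, p (y i) (y (i + 1)) else 0

/-- `ν` is the law of the trajectory of a recurrent Markov chain on a subset of `S` with
non-random initial state: the chain returns to its initial state infinitely often a.s. -/
def IsRecMCLaw {S : Type} [MeasurableSpace S] (ν : Measure (ℕ → S)) : Prop :=
  ∃ (S' : Set S) (p : S → S → ℝ≥0∞) (s0 : S),
    IsMCLaw S' p s0 ν ∧ ν {x | {i : ℕ | x i = s0}.Infinite} = 1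

/-- `ν` is the law of the sequence of vertices visited by (the unique) proper Gibbs measure on
Eulerian paths from `o` to `∞` on a sourced Eulerian digraph whose vertex set is a subset
of `S`. -/
def IsGibbsVertexLaw {S : Type} [MeasurableSpace S] (ν : Measure (ℕ → S)) : Prop :=
  ∃ (Vs : Set S) (E : Type) (mE : MeasurableSpace E) (G : DigraphStruct (↥Vs) E) (o : ↥Vs),
    Countable E ∧ G.IsSourcedEulerian o ∧
    ∃ μp : @Measure (ℕ → E) (@MeasurableSpace.pi ℕ (fun _ => E) fun _ => mE),
      @ProperGibbs (↥Vs) E mE G o μp ∧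
      ∀ A : Set (ℕ → S), MeasurableSet A →
        ν A = μp ((fun (γ : ℕ → E) (i : ℕ) => ((G.src (γ i) : S))) ⁻¹' A)

/-- Concatenation of a finite list with an infinite sequence. -/
def concatSeq {S : Type} (l : List S) (y : ℕ → S) : ℕ → S :=
  fun i => if h : i < l.length then l.get ⟨i, h⟩ else y (i - l.length)

/-- `ν` is the law of a process following a uniform random Eulerian path on a finite Eulerian
digraph with source and sink whose vertex set is a subset of `S`, followed by the trajectory of
an (independent) recurrent Markov chain on a disjoint subset of `S` with non-random initial
state. -/
def IsMixedLaw {S : Type} [MeasurableSpace S] (ν : Measure (ℕ → S)) : Prop :=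
  ∃ (Vf : Finset S) (Ef : Type) (_ : Finite Ef)
    (Gf : DigraphStruct {s : S // s ∈ Vf} Ef) (of zf : {s : S // s ∈ Vf})
    (Vr : Set S) (p : S → S → ℝ≥0∞) (s1 : S) (νMC : Measure (ℕ → S)),
    IsFinEulerian Gf of zf ∧ Disjoint (↑Vf : Set S) Vr ∧
    IsMCLaw Vr p s1 νMC ∧ νMC {x | {i : ℕ | x i = s1}.Infinite} = 1 ∧
    ∀ A : Set (ℕ → S), MeasurableSet A →
      ν A =
        (∑' L : {L : List Ef // IsEulerList Gf of zf L},
            νMC ((fun y => concatSeq (((of : S)) ::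
              (L : List Ef).map fun e => ((Gf.dst e : S))) y) ⁻¹' A)) /
          (Nat.card {L : List Ef // IsEulerList Gf of zf L} : ℝ≥0∞)

section helpers
open scoped Topology

/-- Successive exits from `v` along the path `s :: l`. -/
def stk [DecidableEq S] : S → List S → S → List S
  | _, [], _ => []
  | s, a :: l, v => if v = s then a :: stk a l v else stk a l v

/-- Endpoint of the path `s :: l`. -/
def endp : S → List S → S
  | s, [] => s
  | _, a :: l => endp a l

section comb
variable [DecidableEq S]

lemma stk_prefix (s : S) (l l' : List S) :
    l <+: l' ↔ ∀ v, stk s l v <+: stk s l' v := by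
  induction l generalizing s l' with
  | nil => simp [stk]
  | cons a l ih =>
    cases l' with
    | nil =>
      simp only [List.prefix_nil, reduceCtorEq, false_iff, not_forall]
      exact ⟨s, by simp [stk]⟩
    | cons b l' =>
      rw [List.cons_prefix_cons]
      constructor
      · rintro ⟨rfl, h⟩ v
        have := (ih a l').1 h v
        simp only [stk]
        split_ifs
        · simpa using this
        · exact this
      · intro h
        have hs := h s
        simp only [stk, if_true, List.cons_prefix_cons] at hs
        obtain ⟨rfl, hs⟩ := hs
        refine ⟨rfl, (ih a l').2 fun v => ?_⟩
        by_cases hv : v = s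
        · subst hv; exact hs
        · have := h v
          simpa [stk, hv] using this

lemma stk_inj (s : S) (l l' : List S) (h : ∀ v, stk s l v = stk s l' v) : l = l' := by
  have h1 : l <+: l' := (stk_prefix s l l').2 fun v => by rw [h]
  have h2 : l' <+: l := (stk_prefix s l' l).2 fun v => by rw [h]
  exact h1.eq_of_length_le h2.length_le

lemma stk_ne_nil_mem (s : S) (l : List S) (v : S) (h : stk s l v ≠ []) : v ∈ s :: l := by
  induction l generalizing s with
  | nil => simp [stk] at h
  | cons a l ih =>
    by_cases hv : v = s
    · simp [hv]
    · simp only [stk, hv, if_false] at h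
      exact List.mem_cons_of_mem _ (ih a h)

lemma mem_stk (s : S) (l : List S) (v u : S) (h : u ∈ stk s l v) : u ∈ l := by
  induction l generalizing s with
  | nil => simp [stk] at h
  | cons a l ih =>
    by_cases hv : v = s
    · simp only [stk, hv, if_true, List.mem_cons] at h
      rcases h with h | h
      · simp [h]
      · exact List.mem_cons_of_mem _ (ih a (by rwa [hv]))
    · simp only [stk, hv, if_false] at h
      exact List.mem_cons_of_mem _ (ih a h)

lemma stk_nil_not_mem (s : S) (l : List S) (v : S) (h : stk s l v = []) (hv : v ≠ endp s l) :
    v ∉ s :: l := by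
  induction l generalizing s with
  | nil => simpa [endp] using hv
  | cons a l ih =>
    by_cases hvs : v = s
    · simp [stk, hvs] at h
    · simp only [stk, hvs, if_false] at h
      have := ih a h hv
      simp only [List.mem_cons, not_or] at this ⊢
      exact ⟨hvs, this⟩

lemma stk_balance (s : S) (l : List S) (F : Finset S) (hF : ∀ v, stk s l v ≠ [] → v ∈ F) (v : S) :
    (stk s l v).length + (if v = endp s l then 1 else 0)
      = ∑ u ∈ F, (stk s l u).count v + (if v = s then 1 else 0) := by
  induction l generalizing s with
  | nil =>
    have he : endp s [] = s := rfl
    rw [he]; simp [stk]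
  | cons a l ih =>
    have hs : s ∈ F := hF s (by simp [stk])
    have ih' := ih a (fun v hv => hF v (by simp only [stk]; split_ifs <;> simp [hv]))
    have he : endp s (a :: l) = endp a l := rfl
    rw [he]
    have h1 : ∀ u, (stk s (a :: l) u).count v
        = (stk a l u).count v + (if u = s then (if a = v then 1 else 0) else 0) := by
      intro u
      simp only [stk]
      split_ifs with h1 h2 <;> simp_all
    have h2 : (stk s (a :: l) v).length = (stk a l v).length + (if v = s then 1 else 0) := by
      simp only [stk]; split_ifs <;> simp
    simp only [h1, h2, Finset.sum_add_distrib]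
    rw [Finset.sum_ite_eq' F s]
    simp only [hs, if_true]
    have : (if a = v then 1 else 0) = (if v = a then 1 else 0) := by simp [eq_comm]
    omega

lemma stk_length (s : S) (l : List S) (F : Finset S) (hF : ∀ v, stk s l v ≠ [] → v ∈ F) :
    ∑ u ∈ F, (stk s l u).length = l.length := by
  induction l generalizing s with
  | nil => simp [stk]
  | cons a l ih =>
    have hs : s ∈ F := hF s (by simp [stk])
    have ih' := ih a (fun v hv => hF v (by simp only [stk]; split_ifs <;> simp [hv]))
    have h2 : ∀ v, (stk s (a :: l) v).length = (stk a l v).length + (if v = s then 1 else 0) := by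
      intro v; simp only [stk]; split_ifs <;> simp
    simp only [h2, Finset.sum_add_distrib]
    rw [Finset.sum_ite_eq' F s]
    simp [hs, ih']

lemma stk_rank (s : S) (l : List S) : ∃ ρ : S → ℕ, ∀ v, v ≠ endp s l →
    ∀ u, (stk s l v).getLast? = some u → ρ u < ρ v := by
  induction l generalizing s with
  | nil => exact ⟨fun _ => 0, by simp [stk]⟩
  | cons a l ih =>
    obtain ⟨ρ, hρ⟩ := ih a
    by_cases h : stk a l s = [] ∧ s ≠ endp a l
    · have hm := stk_nil_not_mem a l s h.1 h.2
      refine ⟨Function.update ρ s (ρ a + 1), fun v hv u hu => ?_⟩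
      by_cases hvs : v = s
      · subst hvs
        simp only [stk, if_true, h.1, List.getLast?_singleton, Option.some.injEq] at hu
        subst hu
        have : a ≠ v := by rintro rfl; simp at hm
        simp [Function.update_of_ne this]
      · simp only [stk, hvs, if_false] at hu
        have hus : u ≠ s := by
          rintro rfl
          exact hm (List.mem_cons_of_mem _ (mem_stk _ _ _ _ (List.mem_of_getLast? hu)))
        rw [Function.update_of_ne hus, Function.update_of_ne hvs]
        exact hρ v hv u hu
    · refine ⟨ρ, fun v hv u hu => hρ v hv u ?_⟩
      by_cases hvs : v = s
      · subst hvs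
        have : stk a l v ≠ [] := fun h' => h ⟨h', hv⟩
        simp only [stk, if_true] at hu
        rw [List.getLast?_cons_of_ne_nil this] at hu
        exact hu
      · simpa [stk, hvs] using hu

lemma exists_path (z : S) (ρ : S → ℕ) (F : Finset S) (n : ℕ) : ∀ (s : S) (σ : S → List S),
    (∀ v, v ∉ F → σ v = []) → ∑ u ∈ F, (σ u).length = n →
    (∀ v, (σ v).length + (if v = z then 1 else 0)
      = ∑ u ∈ F, (σ u).count v + (if v = s then 1 else 0)) →
    (∀ v, v ≠ z → ∀ u, (σ v).getLast? = some u → ρ u < ρ v) →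
    ∃ l, (∀ v, stk s l v = σ v) ∧ endp s l = z := by
  induction n with
  | zero =>
    intro s σ hF hn hb hρ
    have h0 : ∀ v, σ v = [] := by
      intro v
      by_cases hv : v ∈ F
      · have := (Finset.sum_eq_zero_iff.1 hn) v hv
        simpa using this
      · exact hF v hv
    refine ⟨[], fun v => by simp [stk, h0], ?_⟩
    have := hb s
    simp only [h0] at this
    by_contra hne
    simp [endp] at hne
    simp [hne] at this
  | succ n ih =>
    intro s σ hF hn hb hρ
    cases hs : σ s with
    | nil =>
      exfalso
      have hbs := hb s
      simp only [hs, List.length_nil, if_true] at hbs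
      have hsz : s = z := by
        by_contra hne
        simp [hne] at hbs
      subst hsz
      have hin : ∀ u, s ∉ σ u := by
        intro u hu
        have hu' : u ∈ F := by
          by_contra h; simp [hF u h] at hu
        have h1 : (σ u).count s ≤ ∑ u ∈ F, (σ u).count s :=
          Finset.single_le_sum (f := fun u => (σ u).count s) (fun _ _ => Nat.zero_le _) hu'
        have h2 := List.count_pos_iff.2 hu
        simp at hbs
        have := hbs u hu'
        omega
      -- minimal rank
      have key : ∀ k v, ρ v = k → σ v = [] := by
        intro k
        induction k using Nat.strong_induction_on with
        | _ k ihk =>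
          intro v hv
          by_contra hne
          have hvs : v ≠ s := by rintro rfl; exact hne hs
          obtain ⟨u, hu⟩ : ∃ u, (σ v).getLast? = some u := by
            exact ⟨_, List.getLast?_eq_some_getLast hne⟩
          have hum := List.mem_of_getLast? hu
          have hus : u ≠ s := by rintro rfl; exact hin v hum
          have hlt := hρ v hvs u hu
          have hσu := ihk (ρ u) (hv ▸ hlt) u rfl
          have := hb u
          simp only [hσu, hus, if_false, List.length_nil] at this
          have hvF : v ∈ F := by by_contra h; exact hne (hF v h)
          have h1 : (σ v).count u ≤ ∑ w ∈ F, (σ w).count u :=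
            Finset.single_le_sum (f := fun w => (σ w).count u) (fun _ _ => Nat.zero_le _) hvF
          have h2 := List.count_pos_iff.2 hum
          omega
      have : ∑ u ∈ F, (σ u).length = 0 := by
        apply Finset.sum_eq_zero; intro u _; simp [key _ u rfl]
      omega
    | cons a r =>
      have hsF : s ∈ F := by by_contra h; simp [hF s h] at hs
      have hl : ∀ v, (σ v).length = (Function.update σ s r v).length + (if v = s then 1 else 0) := by
        intro v
        by_cases hv : v = s
        · subst hv; simp [hs]
        · simp [hv]
      have hc : ∀ w v, (σ v).count w = (Function.update σ s r v).count w
          + (if v = s then (if w = a then 1 else 0) else 0) := by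
        intro w v
        by_cases hv : v = s
        · subst hv; simp [hs, List.count_cons, beq_iff_eq, @eq_comm _ a w]
        · simp [hv]
      obtain ⟨l, hl1, hl2⟩ := ih a (Function.update σ s r) (by
          intro v hv
          have : v ≠ s := by rintro rfl; exact hv hsF
          simp [this, hF v hv]) (by
          simp only [hl, Finset.sum_add_distrib, Finset.sum_ite_eq' F s, hsF, if_true] at hn
          omega) (by
          intro v
          have := hb v
          simp only [hc v, hl v, Finset.sum_add_distrib, Finset.sum_ite_eq' F s, hsF, if_true]
            at this
          omega) (by
          intro v hv u hu
          refine hρ v hv u ?_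
          by_cases hvs : v = s
          · subst hvs
            simp only [Function.update_self] at hu
            rw [hs, List.getLast?_cons_of_ne_nil (by rintro rfl; simp at hu)]
            exact hu
          · simpa [hvs] using hu)
      refine ⟨a :: l, fun v => ?_, hl2⟩
      by_cases hv : v = s
      · subst hv; simp [stk, hl1, hs]
      · simp [stk, hv, hl1]

end comb

section comb2
variable [DecidableEq S]

/-- `v` can be reached along last exits from the endpoint or from an incomplete vertex. -/
def Reach (B : S → List S) (z : S) (σ : S → List S) (v : S) : Prop :=
  ∃ u, (u = z ∨ ¬ (σ u).Perm (B u)) ∧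
    Relation.ReflTransGen (fun a b => (σ a).getLast? = some b) u v

/-- `K` is the finite set of vertices protected from the outside. -/
def IsK (B : S → List S) (Q : Finset S) (s : S) (l : List S) (K : Finset S) : Prop :=
  ∀ v, v ∈ K ↔ ¬ Reach B (endp s l) (stk s l) v ∧ (stk s l v ≠ [] ∨ v ∈ Q)

/-- Acyclicity of the last-exit map inside `K`. -/
def Acyc (K : Finset S) (τ : ↥K → List S) : Prop :=
  ∃ ρ : ↥K → ℕ, ∀ v u : ↥K, (τ v).getLast? = some u.1 → ρ u < ρ v

lemma exists_isK (B : S → List S) (Q : Finset S) (s : S) (l : List S) : ∃ K, IsK B Q s l K := by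
  classical
  refine ⟨((s :: l).toFinset ∪ Q).filter
    (fun v => ¬ Reach B (endp s l) (stk s l) v ∧ (stk s l v ≠ [] ∨ v ∈ Q)), fun v => ?_⟩
  rw [Finset.mem_filter]
  refine ⟨fun h => h.2, fun h => ⟨?_, h⟩⟩
  rcases h.2 with h | h
  · exact Finset.mem_union_left _ (List.mem_toFinset.2 (stk_ne_nil_mem s l v h))
  · exact Finset.mem_union_right _ h

lemma isK_unique {B : S → List S} {Q : Finset S} {s : S} {l : List S} {K K' : Finset S}
    (h : IsK B Q s l K) (h' : IsK B Q s l K') : K = K' := by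
  ext v; rw [h v, h' v]

lemma isK_perm {B : S → List S} {Q : Finset S} {s : S} {l : List S} {K : Finset S}
    (h : IsK B Q s l K) {v : S} (hv : v ∈ K) : v ≠ endp s l ∧ (stk s l v).Perm (B v) := by
  have h1 := ((h v).1 hv).1
  constructor
  · intro hz; exact h1 ⟨v, Or.inl hz, Relation.ReflTransGen.refl⟩
  · by_contra hz; exact h1 ⟨v, Or.inr hz, Relation.ReflTransGen.refl⟩

lemma isK_acyc {B : S → List S} {Q : Finset S} {s : S} {l : List S} {K : Finset S}
    (h : IsK B Q s l K) : Acyc K (fun v => stk s l v.1) := by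
  obtain ⟨ρ, hρ⟩ := stk_rank s l
  exact ⟨fun v => ρ v.1, fun v u hvu => hρ v.1 (isK_perm h v.2).1 u.1 hvu⟩

lemma reach_congr {B : S → List S} {z : S} {σ σ' : S → List S} {K : Finset S}
    (hK : ∀ v ∈ K, ¬ Reach B z σ v) (ho : ∀ v, v ∉ K → σ' v = σ v)
    (hp : ∀ v, (σ' v).Perm (σ v)) (v : S) : Reach B z σ' v ↔ Reach B z σ v := by
  have hseed : ∀ u, (u = z ∨ ¬ (σ' u).Perm (B u)) ↔ (u = z ∨ ¬ (σ u).Perm (B u)) := by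
    intro u
    have : (σ' u).Perm (B u) ↔ (σ u).Perm (B u) :=
      ⟨fun h => (hp u).symm.trans h, fun h => (hp u).trans h⟩
    rw [this]
  constructor
  · rintro ⟨u, hu, hr⟩
    rw [hseed] at hu
    induction hr with
    | refl => exact ⟨u, hu, Relation.ReflTransGen.refl⟩
    | tail _ hbc ih =>
      obtain ⟨u', hu', hr'⟩ := ih
      rename_i b c _
      have hb : b ∉ K := fun hb => hK b hb ⟨u', hu', hr'⟩
      rw [ho b hb] at hbc
      exact ⟨u', hu', hr'.tail hbc⟩
  · rintro ⟨u, hu, hr⟩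
    refine ⟨u, (hseed u).2 hu, ?_⟩
    induction hr with
    | refl => exact Relation.ReflTransGen.refl
    | tail hab hbc ih =>
      rename_i b c
      have hb : b ∉ K := fun hb => hK b hb ⟨u, hu, hab⟩
      exact ih.tail (by rw [ho b hb]; exact hbc)

lemma switch {B : S → List S} {Q : Finset S} {s : S} {l : List S} {K : Finset S}
    (hK : IsK B Q s l K) (τ : ↥K → List S) (hτ : ∀ v, (τ v).Perm (B v.1)) (hac : Acyc K τ) :
    ∃ l', l'.length = l.length ∧ (∀ v, (stk s l' v).Perm (stk s l v)) ∧
      (∀ v, v ∉ K → stk s l' v = stk s l v) ∧ (∀ v : ↥K, stk s l' v.1 = τ v) ∧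
      IsK B Q s l' K := by
  classical
  set σ' : S → List S := fun v => if h : v ∈ K then τ ⟨v, h⟩ else stk s l v with hσ'
  have hin : ∀ v : ↥K, σ' v.1 = τ v := fun v => by simp [hσ']
  have hout : ∀ v, v ∉ K → σ' v = stk s l v := fun v hv => by simp [hσ', hv]
  have hperm : ∀ v, (σ' v).Perm (stk s l v) := by
    intro v
    by_cases hv : v ∈ K
    · rw [hin ⟨v, hv⟩]; exact (hτ _).trans (isK_perm hK hv).2.symm
    · rw [hout v hv]
  have hnr : ∀ v ∈ K, ¬ Reach B (endp s l) (stk s l) v := fun v hv => ((hK v).1 hv).1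
  -- the complement of K is closed under last exits
  have hclosed : ∀ v u, v ∉ K → v ≠ endp s l → (stk s l v).getLast? = some u → u ∉ K := by
    intro v u hv hvz hu huK
    have hvr : Reach B (endp s l) (stk s l) v := by
      by_contra hr
      apply hv
      rw [hK v]
      refine ⟨hr, Or.inl ?_⟩
      intro h; rw [h] at hu; simp at hu
    obtain ⟨w, hw, hr⟩ := hvr
    exact hnr u huK ⟨w, hw, hr.tail hu⟩
  obtain ⟨ρ, hρ⟩ := stk_rank s l
  obtain ⟨r, hr⟩ := hac
  set b : ℕ := K.attach.sup (fun v => ((τ v).getLast?.map ρ).getD 0) with hb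
  have hbb : ∀ v : ↥K, ∀ u, (τ v).getLast? = some u → ρ u ≤ b := by
    intro v u hu
    have : ((τ v).getLast?.map ρ).getD 0 ≤ b :=
      Finset.le_sup (f := fun v : ↥K => ((τ v).getLast?.map ρ).getD 0) (Finset.mem_attach K v)
    simpa [hu] using this
  obtain ⟨l', hl1, hl2⟩ := exists_path (endp s l)
    (fun v => if h : v ∈ K then b + 1 + r ⟨v, h⟩ else ρ v) ((s :: l).toFinset ) l.length s σ'
    (by
      intro v hv
      have : stk s l v = [] := by
        by_contra h; exact hv (List.mem_toFinset.2 (stk_ne_nil_mem s l v h))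
      have h2 := hperm v
      rw [this] at h2
      exact h2.eq_nil)
    (by
      rw [← stk_length s l (s :: l).toFinset
        (fun v h => List.mem_toFinset.2 (stk_ne_nil_mem s l v h))]
      exact Finset.sum_congr rfl fun v _ => (hperm v).length_eq)
    (by
      intro v
      have := stk_balance s l (s :: l).toFinset
        (fun v h => List.mem_toFinset.2 (stk_ne_nil_mem s l v h)) v
      rw [(hperm v).length_eq, this]
      congr 1
      exact Finset.sum_congr rfl fun u _ => ((hperm u).count_eq v).symm)
    (by
      intro v hvz u hu
      by_cases hv : v ∈ K
      · rw [hin ⟨v, hv⟩] at hu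
        by_cases huK : u ∈ K
        · have := hr ⟨v, hv⟩ ⟨u, huK⟩ hu
          simp [hv, huK, this]
        · have := hbb ⟨v, hv⟩ u hu
          simp only [hv, huK, dif_pos, dif_neg, not_false_eq_true]
          omega
      · rw [hout v hv] at hu
        have huK := hclosed v u hv hvz hu
        simp only [hv, huK, dif_neg, not_false_eq_true]
        exact hρ v hvz u hu)
  have hst : stk s l' = σ' := funext hl1
  refine ⟨l', ?_, ?_, ?_, ?_, ?_⟩
  · rw [← stk_length s l' ((s :: l).toFinset ∪ (s :: l').toFinset)
        (fun v h => Finset.mem_union_right _ (List.mem_toFinset.2 (stk_ne_nil_mem s l' v h))),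
      ← stk_length s l ((s :: l).toFinset ∪ (s :: l').toFinset)
        (fun v h => Finset.mem_union_left _ (List.mem_toFinset.2 (stk_ne_nil_mem s l v h)))]
    exact Finset.sum_congr rfl fun v _ => by rw [hst]; exact (hperm v).length_eq
  · rw [hst]; exact hperm
  · rw [hst]; exact hout
  · rw [hst]; exact hin
  · intro v
    rw [hst, hl2, reach_congr hnr hout hperm, hK v]
    have : σ' v ≠ [] ↔ stk s l v ≠ [] := by
      constructor
      · intro h h'; have := hperm v; rw [h'] at this; exact h this.eq_nil
      · intro h h'; have := hperm v; rw [h'] at this; exact h this.symm.eq_nil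
    rw [this]

end comb2

section det
variable [DecidableEq S]

/-- Row of the Laplacian of a single list. -/
def lrow (K : Finset S) (v : ↥K) (l : List S) : ↥K → ℝ :=
  fun u => (if v = u then 1 else 0) - (if l.getLast? = some u.1 then 1 else 0)

open Classical in
lemma det_last (K : Finset S) (τ : ↥K → List S) :
    Matrix.det (Matrix.of fun v => lrow K v (τ v)) = if Acyc K τ then 1 else 0 := by
  set R : ↥K → ↥K → Prop := fun u v => (τ v).getLast? = some u.1 with hR
  by_cases hall : ∀ v, Acc R v
  · have hwf : WellFounded R := ⟨hall⟩
    have hac : Acyc K τ := by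
      have : IsWellFounded ↥K R := ⟨hwf⟩
      refine ⟨fun v => (Finset.univ.filter
        (fun u => IsWellFounded.rank R u < IsWellFounded.rank R v)).card, fun v u h => ?_⟩
      have hlt : IsWellFounded.rank R u < IsWellFounded.rank R v :=
        IsWellFounded.rank_lt_of_rel h
      apply Finset.card_lt_card
      rw [Finset.ssubset_iff_of_subset]
      · exact ⟨u, by simp [hlt], by simp⟩
      · intro w hw
        simp only [Finset.mem_filter, Finset.mem_univ, true_and] at hw ⊢
        exact hw.trans hlt
    rw [if_pos hac]
    obtain ⟨ρ, hρ⟩ := hac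
    have hbt : Matrix.BlockTriangular (Matrix.of fun v => lrow K v (τ v)) (fun v => OrderDual.toDual (ρ v)) := by
      intro i j hij
      have hij' : ρ i < ρ j := hij
      have h1 : i ≠ j := by rintro rfl; exact lt_irrefl _ hij'
      have h2 : ¬ (τ i).getLast? = some j.1 := fun h => by
        have := hρ i j h; omega
      simp [lrow, h1, h2]
    rw [hbt.det]
    apply Finset.prod_eq_one
    intro k _
    have : Matrix.toSquareBlock (Matrix.of fun v => lrow K v (τ v)) (fun v => OrderDual.toDual (ρ v)) k
        = 1 := by
      ext ⟨i, hi⟩ ⟨j, hj⟩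
      have h2 : ¬ (τ i).getLast? = some j.1 := fun h => by
        have := hρ i j h
        have h3 : ρ i = ρ j := by
          have := hi.trans hj.symm
          exact this
        omega
      simp [Matrix.toSquareBlock_def, Matrix.of_apply, lrow, h2, Matrix.one_apply]
    rw [this, Matrix.det_one]
  · have hac : ¬ Acyc K τ := by
      rintro ⟨ρ, hρ⟩
      apply hall
      have : WellFounded R := Subrelation.wf (r := fun u v => ρ u < ρ v)
        (fun {u v} h => hρ v u h) (InvImage.wf ρ Nat.lt_wfRel.wf)
      exact fun v => this.apply v
    rw [if_neg hac]
    push Not at hall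
    obtain ⟨v0, hv0⟩ := hall
    rw [← Matrix.exists_mulVec_eq_zero_iff]
    refine ⟨fun v => if Acc R v then 0 else 1, ?_, ?_⟩
    · intro h
      have := congrFun h v0
      simp [hv0] at this
    · ext v
      simp only [Matrix.mulVec, dotProduct, Matrix.of_apply, lrow, sub_mul, Finset.sum_sub_distrib, Pi.zero_apply,
        ite_mul, one_mul, zero_mul, Finset.sum_ite_eq, Finset.mem_univ, if_true]
      by_cases hv : Acc R v
      · rw [if_pos hv, zero_sub, neg_eq_zero]
        apply Finset.sum_eq_zero
        intro u _
        split_ifs with h1 h2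
        · rfl
        · exact absurd (hv.inv h1) h2
        · rfl
      · rw [if_neg hv]
        have : ∃ u, R u v ∧ ¬ Acc R u := by
          by_contra hcon
          push Not at hcon
          exact hv (Acc.intro v hcon)
        obtain ⟨u, hu, hau⟩ := this
        rw [Finset.sum_eq_single u]
        · have : (τ v).getLast? = some u.1 := hu
          simp [this, hau]
        · intro w _ hw
          rw [if_neg]
          intro h
          have hu' : (τ v).getLast? = some u.1 := hu
          rw [hu'] at h
          exact hw (Subtype.ext (Option.some.inj h).symm)
        · simp

/-- The Laplacian of a family of sets of lists. -/
def Lap (A : S → Finset (List S)) (K : Finset S) : Matrix ↥K ↥K ℝ :=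
  Matrix.of fun v => ∑ l ∈ A v.1, lrow K v l

open Classical in
/-- Set of acyclic configurations. -/
noncomputable def Conf (A : S → Finset (List S)) (K : Finset S) : Finset (↥K → List S) :=
  (Fintype.piFinset (fun v : ↥K => A v.1)).filter (Acyc K)

lemma mtt (A : S → Finset (List S)) (K : Finset S) :
    ((Conf A K).card : ℝ) = (Lap A K).det := by
  classical
  have h := MultilinearMap.map_sum_finset
    (Matrix.detRowAlternating (n := ↥K) (R := ℝ)).toMultilinearMap (fun v l => lrow K v l)
    (fun v : ↥K => A v.1)
  have h' : (Lap A K).det = ∑ r ∈ Fintype.piFinset (fun v : ↥K => A v.1),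
      Matrix.det (Matrix.of fun v => lrow K v (r v)) := h
  rw [h']
  simp only [det_last]
  rw [Finset.sum_ite, Finset.sum_const_zero, add_zero, Finset.sum_const, nsmul_eq_mul, mul_one,
    Conf]

end det

section green
variable [DecidableEq S]

/-- All arrangements of the list `B v`. -/
def Lst (B : S → List S) (v : S) : Finset (List S) := (B v).permutations.toFinset

lemma mem_Lst {B : S → List S} {v : S} {l : List S} : l ∈ Lst B v ↔ l.Perm (B v) := by
  simp [Lst, List.mem_permutations]

lemma count_eq_sum (u : S) (l : List S) :
    l.count u = ∑ k ∈ Finset.range l.length, if l[k]? = some u then 1 else 0 := by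
  induction l with
  | nil => simp
  | cons a l ih =>
    rw [List.length_cons, Finset.sum_range_succ', List.count_cons, ih]
    simp

lemma card_pos_eq (B : S → List S) (v u : S) (k : ℕ) (hk : k < (B v).length) :
    ((Lst B v).filter (fun l => l[k]? = some u)).card
      = ((Lst B v).filter (fun l => l.getLast? = some u)).card := by
  apply le_antisymm
  · refine Finset.card_le_card_of_injOn (fun l => l.rotate (k + 1)) ?_
      (fun a _ b _ h => List.rotate_injective _ h)
    intro l hl
    simp only [Finset.coe_filter, Set.mem_setOf_eq, mem_Lst] at hl ⊢
    have hlen := hl.1.length_eq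
    refine ⟨(List.rotate_perm l _).trans hl.1, ?_⟩
    rw [List.getLast?_eq_getElem?, List.length_rotate, List.getElem?_rotate (by omega)]
    have : (l.length - 1 + (k + 1)) % l.length = k := by
      rw [show l.length - 1 + (k + 1) = k + l.length by omega, Nat.add_mod_right,
        Nat.mod_eq_of_lt (by omega)]
    rw [this]; exact hl.2
  · refine Finset.card_le_card_of_injOn (fun l => l.rotate ((B v).length - (k + 1))) ?_
      (fun a _ b _ h => List.rotate_injective _ h)
    intro l hl
    simp only [Finset.coe_filter, Set.mem_setOf_eq, mem_Lst] at hl ⊢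
    have hlen := hl.1.length_eq
    refine ⟨(List.rotate_perm l _).trans hl.1, ?_⟩
    rw [List.getElem?_rotate (by omega)]
    have : (k + ((B v).length - (k + 1))) % l.length = l.length - 1 := by
      rw [show k + ((B v).length - (k + 1)) = l.length - 1 by omega,
        Nat.mod_eq_of_lt (by omega)]
    rw [this, ← List.getLast?_eq_getElem?]; exact hl.2

lemma card_last (B : S → List S) (v u : S) :
    (Lst B v).card * (B v).count u
      = (B v).length * ((Lst B v).filter (fun l => l.getLast? = some u)).card := by
  have h1 : ∑ l ∈ Lst B v, ∑ k ∈ Finset.range (B v).length, (if l[k]? = some u then 1 else 0)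
      = (Lst B v).card * (B v).count u := by
    rw [Finset.sum_congr rfl (g := fun _ => (B v).count u), Finset.sum_const, smul_eq_mul]
    intro l hl
    rw [mem_Lst] at hl
    rw [← hl.length_eq, ← count_eq_sum, hl.count_eq]
  rw [← h1, Finset.sum_comm]
  rw [Finset.sum_congr rfl (g := fun _ =>
    ((Lst B v).filter (fun l => l.getLast? = some u)).card), Finset.sum_const, smul_eq_mul,
    Finset.card_range]
  intro k hk
  rw [← Finset.sum_filter, ← Finset.card_eq_sum_ones, card_pos_eq B v u k (Finset.mem_range.1 hk)]

lemma Lst_card_pos (B : S → List S) (v : S) : 0 < (Lst B v).card :=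
  Finset.card_pos.2 ⟨B v, mem_Lst.2 (List.Perm.refl _)⟩

/-- Transition probabilities. -/
noncomputable def tp (B : S → List S) (v u : S) : ℝ := ((B v).count u : ℝ) / ((B v).length : ℝ)

lemma tp_nonneg (B : S → List S) (v u : S) : 0 ≤ tp B v u := by unfold tp; positivity

lemma length_mul_tp (B : S → List S) (v u : S) :
    ((B v).length : ℝ) * tp B v u = ((B v).count u : ℝ) := by
  unfold tp
  by_cases h : (B v).length = 0
  · have : B v = [] := by simpa using h
    simp [this]
  · field_simp

lemma card_last' (B : S → List S) (v u : S) :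
    ∑ l ∈ Lst B v, (if l.getLast? = some u then (1 : ℝ) else 0) = (Lst B v).card * tp B v u := by
  rw [← Finset.sum_filter, Finset.sum_const, nsmul_eq_mul, mul_one]
  have h := card_last B v u
  unfold tp
  by_cases h0 : (B v).length = 0
  · have hb : B v = [] := by simpa using h0
    have : (Lst B v).filter (fun l => l.getLast? = some u) = ∅ := by
      rw [Finset.filter_eq_empty_iff]
      intro l hl
      rw [mem_Lst, hb] at hl
      rw [hl.eq_nil]; simp
    simp [this, hb]
  · have h0' : ((B v).length : ℝ) ≠ 0 := by exact_mod_cast h0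
    field_simp
    exact_mod_cast (by rw [mul_comm]; exact h.symm)

/-- Truncated Green function. -/
noncomputable def gn (p : S → S → ℝ) (K : Finset S) : ℕ → S → S → ℝ
  | 0 => fun _ _ => 0
  | n + 1 => fun w u => (if w = u then 1 else 0) + ∑ v ∈ K, p w v * gn p K n v u

variable {p : S → S → ℝ}

lemma gn_nonneg (hp : ∀ v u, 0 ≤ p v u) (K : Finset S) (n : ℕ) (w u : S) : 0 ≤ gn p K n w u := by
  induction n generalizing w with
  | zero => simp [gn]
  | succ n ih =>
    simp only [gn]
    have : 0 ≤ ∑ v ∈ K, p w v * gn p K n v u :=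
      Finset.sum_nonneg fun v _ => mul_nonneg (hp _ _) (ih v)
    split_ifs <;> linarith

lemma gn_mono_succ (hp : ∀ v u, 0 ≤ p v u) (K : Finset S) (n : ℕ) (w u : S) :
    gn p K n w u ≤ gn p K (n + 1) w u := by
  induction n generalizing w with
  | zero => exact gn_nonneg hp K 1 w u
  | succ n ih =>
    change (if w = u then (1 : ℝ) else 0) + ∑ v ∈ K, p w v * gn p K n v u
      ≤ (if w = u then (1 : ℝ) else 0) + ∑ v ∈ K, p w v * gn p K (n + 1) v u
    exact add_le_add le_rfl
      (Finset.sum_le_sum fun v _ => mul_le_mul_of_nonneg_left (ih v) (hp _ _))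

lemma gn_mono_set (hp : ∀ v u, 0 ≤ p v u) {K K' : Finset S} (h : K ⊆ K') (n : ℕ) (w u : S) :
    gn p K n w u ≤ gn p K' n w u := by
  induction n generalizing w with
  | zero => simp [gn]
  | succ n ih =>
    change (if w = u then (1 : ℝ) else 0) + ∑ v ∈ K, p w v * gn p K n v u
      ≤ (if w = u then (1 : ℝ) else 0) + ∑ v ∈ K', p w v * gn p K' n v u
    refine add_le_add le_rfl ?_
    calc ∑ v ∈ K, p w v * gn p K n v u ≤ ∑ v ∈ K, p w v * gn p K' n v u := by
          gcongr with v hv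
          · exact hp _ _
          · exact ih v
      _ ≤ ∑ v ∈ K', p w v * gn p K' n v u :=
          Finset.sum_le_sum_of_subset_of_nonneg h
            fun v _ _ => mul_nonneg (hp _ _) (gn_nonneg hp _ _ _ _)

/-- The two structural hypotheses on the prescribed exits. -/
structure Good (B : S → List S) (s0 : S) : Prop where
  bal : ∀ (u : S) (K : Finset S),
    ∑ v ∈ K, (B v).count u + (if u = s0 then 1 else 0) ≤ (B u).length
  conn : ∀ w, B w ≠ [] → Relation.ReflTransGen (fun a b => b ∈ B a) s0 w

lemma gn_bound_s0 {B : S → List S} {s0 : S} (hB : Good B s0) (K : Finset S) (hs : s0 ∈ K) (n : ℕ)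
    (u : S) : gn (tp B) K n s0 u ≤ (B u).length := by
  have hp := tp_nonneg B
  have h1 : ∑ v ∈ K, (((B v).length : ℝ) - ∑ w ∈ K, ((B w).count v : ℝ)) * gn (tp B) K n v u
      ≤ (B u).length := by
    have e1 : ∑ v ∈ K, (∑ w ∈ K, ((B w).count v : ℝ)) * gn (tp B) K n v u
        = ∑ w ∈ K, ((B w).length : ℝ) * (gn (tp B) K (n + 1) w u - (if w = u then 1 else 0)) := by
      simp only [gn, add_sub_cancel_left, Finset.sum_mul, Finset.mul_sum]
      rw [Finset.sum_comm]
      refine Finset.sum_congr rfl fun w _ => Finset.sum_congr rfl fun v _ => ?_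
      rw [← length_mul_tp]; ring
    simp only [sub_mul, Finset.sum_sub_distrib]
    rw [e1]
    simp only [mul_sub, Finset.sum_sub_distrib]
    have e2 : ∑ x ∈ K, ((B x).length : ℝ) * (if x = u then 1 else 0) ≤ (B u).length := by
      simp only [mul_ite, mul_one, mul_zero, Finset.sum_ite_eq']
      split_ifs <;> simp
    have e3 : ∑ v ∈ K, ((B v).length : ℝ) * gn (tp B) K n v u
        ≤ ∑ v ∈ K, ((B v).length : ℝ) * gn (tp B) K (n + 1) v u := by
      gcongr with v hv
      exact gn_mono_succ hp K n v u
    linarith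
  refine le_trans ?_ h1
  have h2 : ∀ v ∈ K, (if v = s0 then 1 else 0) * gn (tp B) K n v u
      ≤ (((B v).length : ℝ) - ∑ w ∈ K, ((B w).count v : ℝ)) * gn (tp B) K n v u := by
    intro v hv
    refine mul_le_mul_of_nonneg_right ?_ (gn_nonneg hp _ _ _ _)
    have := hB.bal v K
    have h3 : ((∑ w ∈ K, (B w).count v + (if v = s0 then 1 else 0) : ℕ) : ℝ) ≤ (B v).length := by
      exact_mod_cast this
    push_cast at h3
    linarith
  refine le_trans ?_ (Finset.sum_le_sum h2)
  simp [hs]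

lemma gn_bound {B : S → List S} {s0 : S} (hB : Good B s0) (w u : S) :
    ∃ C : ℝ, ∀ K n, gn (tp B) K n w u ≤ C := by
  have hp := tp_nonneg B
  by_cases hw : B w = []
  · refine ⟨1, fun K n => ?_⟩
    cases n with
    | zero => simp [gn]
    | succ n =>
      have : ∀ v, tp B w v = 0 := by simp [tp, hw]
      simp only [gn, this, zero_mul, Finset.sum_const_zero, add_zero]
      split_ifs <;> norm_num
  · have h := hB.conn w hw
    clear hw
    induction h with
    | refl =>
      refine ⟨(B u).length, fun K n => ?_⟩
      exact (gn_mono_set hp (Finset.subset_insert s0 K) n s0 u).trans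
        (gn_bound_s0 hB _ (Finset.mem_insert_self _ _) n u)
    | tail _ hab ih =>
      rename_i a b _
      obtain ⟨C, hC⟩ := ih
      have hpos : 0 < tp B a b := by
        unfold tp
        have h1 := List.count_pos_iff.2 hab
        have h2 := List.length_pos_of_mem hab
        positivity
      refine ⟨C / tp B a b, fun K n => ?_⟩
      rw [le_div_iff₀ hpos]
      refine le_trans ?_ (hC (insert b K) (n + 1))
      have h1 := gn_mono_set hp (Finset.subset_insert b K) n b u
      have h2 : tp B a b * gn (tp B) (insert b K) n b u
          ≤ ∑ v ∈ insert b K, tp B a v * gn (tp B) (insert b K) n v u :=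
        Finset.single_le_sum (f := fun v => tp B a v * gn (tp B) (insert b K) n v u)
          (fun v _ => mul_nonneg (hp _ _) (gn_nonneg hp _ _ _ _)) (Finset.mem_insert_self _ _)
      simp only [gn]
      have h3 : (0:ℝ) ≤ if a = u then 1 else 0 := by split_ifs <;> norm_num
      nlinarith

/-- Green function. -/
noncomputable def gr (B : S → List S) (K : Finset S) (w u : S) : ℝ := ⨆ n, gn (tp B) K n w u

lemma gr_tendsto {B : S → List S} {s0 : S} (hB : Good B s0) (K : Finset S) (w u : S) :
    Tendsto (fun n => gn (tp B) K n w u) atTop (𝓝 (gr B K w u)) := by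
  obtain ⟨C, hC⟩ := gn_bound hB w u
  exact tendsto_atTop_ciSup (monotone_nat_of_le_succ fun n => gn_mono_succ (tp_nonneg B) K n w u)
    ⟨C, by rintro _ ⟨n, rfl⟩; exact hC K n⟩

lemma gr_rec {B : S → List S} {s0 : S} (hB : Good B s0) (K : Finset S) (w u : S) :
    gr B K w u = (if w = u then 1 else 0) + ∑ v ∈ K, tp B w v * gr B K v u := by
  have h1 := (gr_tendsto hB K w u).comp (tendsto_add_atTop_nat 1)
  have h2 : Tendsto (fun n => (if w = u then 1 else 0) + ∑ v ∈ K, tp B w v * gn (tp B) K n v u)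
      atTop (𝓝 ((if w = u then 1 else 0) + ∑ v ∈ K, tp B w v * gr B K v u)) :=
    tendsto_const_nhds.add (tendsto_finset_sum _ fun v _ => (gr_tendsto hB K v u).const_mul _)
  exact tendsto_nhds_unique h1 h2

lemma gr_lim {B : S → List S} {s0 : S} (hB : Good B s0) (w u : S) :
    ∃ g, Tendsto (fun K => gr B K w u) atTop (𝓝 g) := by
  obtain ⟨C, hC⟩ := gn_bound hB w u
  refine ⟨_, tendsto_atTop_ciSup (f := fun K => gr B K w u) ?_ ⟨C, ?_⟩⟩
  · intro K K' h
    exact le_of_tendsto_of_tendsto' (gr_tendsto hB K w u) (gr_tendsto hB K' w u)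
      fun n => gn_mono_set (tp_nonneg B) h n w u
  · rintro _ ⟨K, rfl⟩
    exact le_of_tendsto' (gr_tendsto hB K w u) fun n => hC K n

/-- Green function at the last element of a list. -/
noncomputable def gl (B : S → List S) (K : Finset S) (l : List S) (u : S) : ℝ :=
  match l.getLast? with
  | none => 0
  | some w => if w ∈ K then gr B K w u else 0

lemma gl_lim {B : S → List S} {s0 : S} (hB : Good B s0) (l : List S) (u : S) :
    ∃ g, Tendsto (fun K => gl B K l u) atTop (𝓝 g) := by
  unfold gl
  cases l.getLast? with
  | none => exact ⟨0, tendsto_const_nhds⟩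
  | some w =>
    obtain ⟨g, hg⟩ := gr_lim hB w u
    refine ⟨g, hg.congr' ?_⟩
    filter_upwards [eventually_ge_atTop {w}] with K hK
    have : w ∈ K := hK (Finset.mem_singleton_self w)
    simp [this]

/-- The matrix `G_K`. -/
noncomputable def Gm (B : S → List S) (K : Finset S) : Matrix ↥K ↥K ℝ :=
  Matrix.of fun w u => gr B K w.1 u.1

lemma lrow_mul (B : S → List S) (K : Finset S) (v u : ↥K) (l : List S) :
    ∑ w : ↥K, lrow K v l w * Gm B K w u = gr B K v u - gl B K l u := by
  simp only [lrow, sub_mul, Finset.sum_sub_distrib, ite_mul, one_mul, zero_mul, Finset.sum_ite_eq,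
    Finset.mem_univ, if_true, Gm, Matrix.of_apply]
  congr 1
  unfold gl
  cases l.getLast? with
  | none => simp
  | some w =>
    simp only [Option.some.injEq]
    by_cases hw : w ∈ K
    · rw [Finset.sum_eq_single ⟨w, hw⟩]
      · simp [hw]
      · intro b _ hb
        rw [if_neg]
        rintro rfl
        exact hb rfl
      · simp
    · rw [if_neg hw]
      apply Finset.sum_eq_zero
      intro x _
      rw [if_neg]
      rintro rfl
      exact hw x.2

lemma Lap_mul (B : S → List S) (A : S → Finset (List S)) (K : Finset S) (v u : ↥K) :
    (Lap A K * Gm B K) v u = ∑ l ∈ A v.1, (gr B K v u - gl B K l u) := by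
  simp only [Matrix.mul_apply, Lap, Matrix.of_apply, Finset.sum_apply, Finset.sum_mul]
  rw [Finset.sum_comm]
  exact Finset.sum_congr rfl fun l _ => lrow_mul B K v u l

lemma Lap_Lst_mul {B : S → List S} {s0 : S} (hB : Good B s0) (K : Finset S) (v u : ↥K) :
    (Lap (Lst B) K * Gm B K) v u = if v = u then ((Lst B v.1).card : ℝ) else 0 := by
  simp only [Matrix.mul_apply, Lap, Matrix.of_apply, Finset.sum_apply, lrow, Gm]
  simp only [Finset.sum_sub_distrib, card_last', Finset.sum_const, nsmul_eq_mul, sub_mul]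
  rw [Finset.univ_eq_attach]
  have e1 : ∑ x ∈ K.attach, ((Lst B v.1).card : ℝ) * (if v = x then 1 else 0) * gr B K x u
      = (Lst B v.1).card * gr B K v u := by
    rw [Finset.sum_eq_single v]
    · simp
    · intro b _ hb; simp [hb.symm]
    · simp
  have e2 : ∑ x ∈ K.attach, ((Lst B v.1).card : ℝ) * tp B v x * gr B K x u
      = (Lst B v.1).card * ∑ x ∈ K, tp B v x * gr B K x u := by
    rw [← Finset.sum_attach K (fun x => tp B v x * gr B K x u), Finset.mul_sum]
    exact Finset.sum_congr rfl fun _ _ => by ring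
  rw [e1, e2, gr_rec hB K v u]
  by_cases h : v = u
  · subst h; simp; ring
  · have h' : v.1 ≠ u.1 := fun h' => h (Subtype.ext h')
    simp [h, h']

lemma Lap_Lst_det {B : S → List S} {s0 : S} (hB : Good B s0) (K : Finset S) :
    (Lap (Lst B) K).det * (Gm B K).det = ∏ v : ↥K, ((Lst B v.1).card : ℝ) := by
  rw [← Matrix.det_mul, ← Matrix.det_diagonal]
  congr 1
  ext v u
  rw [Lap_Lst_mul hB, Matrix.diagonal_apply]

lemma prod_ne (B : S → List S) (K : Finset S) : ∏ v : ↥K, ((Lst B v.1).card : ℝ) ≠ 0 :=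
  Finset.prod_ne_zero_iff.2 fun v _ => by have := Lst_card_pos B v.1; positivity

lemma Conf_card_ne {B : S → List S} {s0 : S} (hB : Good B s0) (K : Finset S) :
    ((Conf (Lst B) K).card : ℝ) ≠ 0 := by
  intro h
  rw [mtt] at h
  apply prod_ne B K
  rw [← Lap_Lst_det hB, h, zero_mul]

/-- The finite matrix whose determinant gives the probabilities. -/
noncomputable def Xm (B : S → List S) (A : S → Finset (List S)) (X K : Finset S) :
    Matrix ↥X ↥X ℝ :=
  Matrix.of fun v u => ((Lst B v.1).card : ℝ)⁻¹ * ∑ l ∈ A v.1, (gr B K v u - gl B K l u)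

lemma ratio_eq {B : S → List S} {s0 : S} (hB : Good B s0) (A : S → Finset (List S))
    (X K : Finset S) (hX : ∀ v, v ∉ X → A v = Lst B v) (hXK : X ⊆ K) :
    ((Conf A K).card : ℝ) / ((Conf (Lst B) K).card : ℝ) = (Xm B A X K).det := by
  have h1 := Lap_Lst_det hB K
  have h2 := prod_ne B K
  have hL : (Lap (Lst B) K).det ≠ 0 := fun h => h2 (by rw [← h1, h, zero_mul])
  have hG : (Gm B K).det ≠ 0 := fun h => h2 (by rw [← h1, h, mul_zero])
  rw [mtt, mtt]
  set N : Matrix ↥K ↥K ℝ :=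
    Matrix.diagonal (fun v : ↥K => ((Lst B v.1).card : ℝ)⁻¹) * (Lap A K * Gm B K) with hN
  have hNdet : N.det = (Lap A K).det / (Lap (Lst B) K).det := by
    rw [hN, Matrix.det_mul, Matrix.det_mul, Matrix.det_diagonal, Finset.prod_inv_distrib, ← h1]
    field_simp
  have hNrow : ∀ v u : ↥K, v.1 ∉ X → N v u = if v = u then 1 else 0 := by
    intro v u hv
    rw [hN, Matrix.diagonal_mul, Lap_mul, hX v.1 hv, ← Lap_mul, Lap_Lst_mul hB]
    have := Lst_card_pos B v.1
    split_ifs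
    · field_simp
    · simp
  rw [← hNdet, Matrix.twoBlockTriangular_det N (fun v => v.1 ∈ X)]
  · have e1 : (N.toSquareBlockProp fun v => ¬ v.1 ∈ X) = 1 := by
      ext ⟨v, hv⟩ ⟨u, hu⟩
      simp [Matrix.toSquareBlockProp_def, hNrow v u hv, Matrix.one_apply]
    rw [e1, Matrix.det_one, mul_one]
    let e : ↥X ≃ {v : ↥K // v.1 ∈ X} :=
      { toFun := fun v => ⟨⟨v.1, hXK v.2⟩, v.2⟩
        invFun := fun v => ⟨v.1.1, v.2⟩
        left_inv := fun _ => rfl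
        right_inv := fun _ => rfl }
    rw [← Matrix.det_submatrix_equiv_self e]
    congr 1
    ext v u
    simp only [Matrix.submatrix_apply, Matrix.toSquareBlockProp_def, Matrix.of_apply, Xm, hN,
      Matrix.diagonal_mul, Lap_mul]
    rfl
  · intro i hi j hj
    rw [hNrow i j hi, if_neg]
    rintro rfl
    exact hi hj

lemma ratio_lim {B : S → List S} {s0 : S} (hB : Good B s0) (A : S → Finset (List S))
    (X : Finset S) (hX : ∀ v, v ∉ X → A v = Lst B v) :
    ∃ q, Tendsto (fun K => ((Conf A K).card : ℝ) / ((Conf (Lst B) K).card : ℝ)) atTop (𝓝 q) := by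
  choose g hg using gr_lim hB
  choose g' hg' using gl_lim hB
  let Y : Matrix ↥X ↥X ℝ :=
    Matrix.of fun v u => ((Lst B v.1).card : ℝ)⁻¹ * ∑ l ∈ A v.1, (g v u - g' l u)
  have hY : Tendsto (fun K => Xm B A X K) atTop (𝓝 Y) := by
    refine tendsto_pi_nhds.2 fun v => tendsto_pi_nhds.2 fun u => ?_
    exact (tendsto_finset_sum _ fun l _ => (hg v u).sub (hg' l u)).const_mul _
  refine ⟨Y.det, ?_⟩
  have hc : Continuous (fun M : Matrix ↥X ↥X ℝ => M.det) := continuous_id.matrix_det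
  refine ((hc.tendsto Y).comp hY).congr' ?_
  filter_upwards [eventually_ge_atTop X] with K hK
  exact (ratio_eq hB A X K hX hK).symm

end green

/-- The states `ω 1, …, ω n`. -/
def pre : ℕ → (ℕ → S) → List S
  | 0, _ => []
  | n + 1, ω => ω 1 :: pre n (fun i => ω (i + 1))

section paths

lemma pre_length (n : ℕ) (ω : ℕ → S) : (pre n ω).length = n := by
  induction n generalizing ω with
  | zero => rfl
  | succ n ih => simp [pre, ih]

lemma pre_eq_iff (n : ℕ) (ω ω' : ℕ → S) :
    pre n ω = pre n ω' ↔ ∀ i < n, ω (i + 1) = ω' (i + 1) := by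
  induction n generalizing ω ω' with
  | zero => simp [pre]
  | succ n ih =>
    simp only [pre, List.cons.injEq, ih]
    constructor
    · rintro ⟨h0, h⟩ i hi
      rcases i with _ | i
      · exact h0
      · exact h i (by omega)
    · intro h
      exact ⟨h 0 (by omega), fun i hi => h (i + 1) (by omega)⟩

lemma cyl_iff (n : ℕ) (ω ω' : ℕ → S) :
    (∀ i ≤ n, ω i = ω' i) ↔ ω 0 = ω' 0 ∧ pre n ω = pre n ω' := by
  rw [pre_eq_iff]
  constructor
  · intro h
    exact ⟨h 0 (by omega), fun i hi => h (i + 1) (by omega)⟩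
  · rintro ⟨h0, h⟩ i hi
    rcases i with _ | i
    · exact h0
    · exact h i (by omega)

lemma endp_pre (n : ℕ) (ω : ℕ → S) : endp (ω 0) (pre n ω) = ω n := by
  induction n generalizing ω with
  | zero => rfl
  | succ n ih => simpa [pre, endp] using ih (fun i => ω (i + 1))

lemma pre_prefix {n N : ℕ} (h : n ≤ N) (ω : ℕ → S) : pre n ω <+: pre N ω := by
  induction n generalizing ω N with
  | zero => simp [pre]
  | succ n ih =>
    obtain ⟨N, rfl⟩ : ∃ k, N = k + 1 := ⟨N - 1, by omega⟩
    simp only [pre, List.cons_prefix_cons, true_and]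
    exact ih (by omega) _

lemma exists_seq (s : S) (l : List S) : ∃ x : ℕ → S, x 0 = s ∧ pre l.length x = l := by
  induction l generalizing s with
  | nil => exact ⟨fun _ => s, rfl, rfl⟩
  | cons a l ih =>
    obtain ⟨x, h0, hx⟩ := ih a
    refine ⟨fun i => Nat.casesOn i s x, rfl, ?_⟩
    simp only [List.length_cons, pre]
    rw [← h0]
    congr 1


lemma transient_bound {ω : ℕ → S} (hω : ∀ s, {i : ℕ | ω i = s}.Finite) (F : Finset S) :
    ∃ T, ∀ j, T ≤ j → ω j ∉ F := by
  have : {i : ℕ | ω i ∈ F}.Finite := by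
    have h : {i : ℕ | ω i ∈ F} = ⋃ s ∈ F, {i : ℕ | ω i = s} := by
      ext i; simp
    rw [h]
    exact F.finite_toSet.biUnion fun s _ => hω s
  obtain ⟨T, hT⟩ := this.bddAbove
  refine ⟨T + 1, fun j hj hF => ?_⟩
  have := hT hF
  omega

variable [DecidableEq S]

lemma count_stk_pre (N : ℕ) (ω : ℕ → S) (u v : S) :
    (stk (ω 0) (pre N ω) u).count v
      = ((Finset.range N).filter (fun i => ω i = u ∧ ω (i + 1) = v)).card := by
  induction N generalizing ω with
  | zero => simp [pre, stk]
  | succ N ih =>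
    rw [Finset.card_filter, Finset.sum_range_succ', ← Finset.card_filter]
    have := ih (fun i => ω (i + 1))
    simp only [zero_add] at this ⊢
    rw [← this]
    simp only [pre, stk]
    by_cases hu : u = ω 0
    · subst hu
      simp [List.count_cons]
    · simp [hu, Ne.symm hu]

lemma transCount_eq (N : ℕ) (ω : ℕ → S) (u v : S) :
    transCount ω N u v = (stk (ω 0) (pre N ω) u).count v := by
  rw [count_stk_pre, transCount, ← Set.ncard_coe_finset]
  congr 1
  ext i
  simp

lemma transNum_eq (N : ℕ) (ω : ℕ → S) (u v : S) (h : ∀ j, N ≤ j → ω j ≠ u) :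
    transNum ω u v = ((stk (ω 0) (pre N ω) u).count v : ℕ∞) := by
  rw [count_stk_pre, transNum, ← Set.encard_coe_eq_coe_finsetCard]
  congr 1
  ext i
  simp only [Set.mem_ofPred_eq, Finset.coe_filter, Finset.mem_range]
  refine ⟨fun hi => ⟨?_, hi⟩, fun hi => hi.2⟩
  by_contra hN
  exact h i (by omega) hi.1

lemma stk_pre_nil (N : ℕ) (ω : ℕ → S) (a : S) (h : stk (ω 0) (pre N ω) a = []) (j : ℕ)
    (hj : j < N) : ω j ≠ a := by
  intro hja
  have := count_stk_pre N ω a (ω (j + 1))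
  rw [h, List.count_nil] at this
  have h2 := Finset.card_eq_zero.1 this.symm
  have : j ∈ (Finset.range N).filter (fun i => ω i = a ∧ ω (i + 1) = ω (j + 1)) := by
    simp [hj, hja]
  rw [h2] at this
  simp at this

lemma getLast_stk_pre (N : ℕ) (ω : ℕ → S) (a b : S)
    (h : (stk (ω 0) (pre N ω) a).getLast? = some b) :
    ∃ i < N, ω i = a ∧ ω (i + 1) = b ∧ ∀ j, i < j → j < N → ω j ≠ a := by
  induction N generalizing ω with
  | zero => simp [pre, stk] at h
  | succ N ih =>
    have key : (stk (ω 1) (pre N fun i => ω (i + 1)) a).getLast? = some b →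
        ∃ i < N + 1, ω i = a ∧ ω (i + 1) = b ∧ ∀ j, i < j → j < N + 1 → ω j ≠ a := by
      intro h
      obtain ⟨i, hi, h1, h2, h3⟩ := ih (fun i => ω (i + 1)) h
      refine ⟨i + 1, by omega, h1, h2, fun j hj hjN => ?_⟩
      have := h3 (j - 1) (by omega) (by omega)
      rwa [show j - 1 + 1 = j by omega] at this
    simp only [pre, stk] at h
    split_ifs at h with ha
    · rcases hs : stk (ω 1) (pre N fun i => ω (i + 1)) a with _ | ⟨c, t⟩
      · rw [hs] at h
        simp only [List.getLast?_singleton, Option.some.injEq] at h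
        refine ⟨0, by omega, ha.symm, h, fun j hj hjN => ?_⟩
        have := stk_pre_nil N (fun i => ω (i + 1)) a hs (j - 1) (by omega)
        rwa [show j - 1 + 1 = j by omega] at this
      · rw [hs, List.getLast?_cons_cons, ← hs] at h
        exact key h
    · exact key h

lemma complete_perm {ω : ℕ → S} {B : S → List S}
    (hM : ∀ u v, transNum ω u v = ((B u).count v : ℕ∞)) (N : ℕ) (u : S)
    (h : ∀ j, N ≤ j → ω j ≠ u) : (stk (ω 0) (pre N ω) u).Perm (B u) := by
  rw [List.perm_iff_count]
  intro v
  have := hM u v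
  rw [transNum_eq N ω u v h] at this
  exact_mod_cast this

lemma ev_isK {ω : ℕ → S} {B : S → List S} (hω : ∀ s, {i : ℕ | ω i = s}.Finite)
    (hM : ∀ u v, transNum ω u v = ((B u).count v : ℕ∞)) (Q : Finset S) :
    ∀ᶠ N in atTop, ∀ K, IsK B Q (ω 0) (pre N ω) K → Q ⊆ K := by
  obtain ⟨T, hT⟩ := transient_bound hω Q
  obtain ⟨N0, hN0⟩ := transient_bound hω ((Finset.range T).image ω)
  filter_upwards [eventually_ge_atTop (max T N0)] with N hN K hK v hv
  have hNT : T ≤ N := le_trans (le_max_left _ _) hN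
  have hNN : N0 ≤ N := le_trans (le_max_right _ _) hN
  rw [hK v]
  refine ⟨?_, Or.inr hv⟩
  rintro ⟨u, hu, hr⟩
  have key : ∀ j, T ≤ j → ω j ≠ u := by
    clear hu
    induction hr using Relation.ReflTransGen.head_induction_on with
    | refl => intro j hj h; exact hT j hj (h ▸ hv)
    | head hab _ ih =>
      obtain ⟨i, hi, h1, h2, h3⟩ := getLast_stk_pre N ω _ _ hab
      have hiT : i + 1 < T := by
        by_contra h
        exact ih (i + 1) (by omega) h2
      intro j hj
      by_cases hjN : j < N
      · exact h3 j (by omega) hjN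
      · intro h
        refine hN0 j (by omega) ?_
        rw [h, ← h1]
        exact Finset.mem_image_of_mem _ (Finset.mem_range.2 (by omega))
  rcases hu with hu | hu
  · rw [endp_pre] at hu
    exact key N hNT hu.symm
  · exact hu (complete_perm hM N u fun j hj => key j (by omega))

lemma exists_B {ω : ℕ → S} (hω : ∀ s, {i : ℕ | ω i = s}.Finite) :
    ∃ B : S → List S, (∀ u v, transNum ω u v = ((B u).count v : ℕ∞)) ∧ Good B (ω 0) := by
  have hT0 : ∀ u, ∃ T, ∀ j, T ≤ j → ω j ≠ u := by
    intro u
    obtain ⟨T, hT⟩ := transient_bound hω {u}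
    exact ⟨T, fun j hj h => hT j hj (by simp [h])⟩
  choose T hT using hT0
  have hM : ∀ u v, transNum ω u v = ((stk (ω 0) (pre (T u) ω) u).count v : ℕ∞) :=
    fun u v => transNum_eq _ _ _ _ (hT u)
  refine ⟨fun u => stk (ω 0) (pre (T u) ω) u, hM, ?_, ?_⟩
  · intro u K
    obtain ⟨N, hN⟩ := transient_bound hω (insert u K)
    have hp : ∀ v ∈ insert u K, (stk (ω 0) (pre N ω) v).Perm (stk (ω 0) (pre (T v) ω) v) := by
      intro v hv
      exact complete_perm hM N v fun j hj h => hN j hj (h ▸ hv)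
    have hb := stk_balance (ω 0) (pre N ω) ((ω 0 :: pre N ω).toFinset ∪ K)
      (fun v hv => Finset.mem_union_left _ (List.mem_toFinset.2 (stk_ne_nil_mem _ _ v hv))) u
    rw [endp_pre, if_neg, add_zero, (hp u (Finset.mem_insert_self _ _)).length_eq] at hb
    · rw [hb]
      gcongr ?_ + _
      calc ∑ v ∈ K, (stk (ω 0) (pre (T v) ω) v).count u
          = ∑ v ∈ K, (stk (ω 0) (pre N ω) v).count u :=
            Finset.sum_congr rfl fun v hv =>
              ((hp v (Finset.mem_insert_of_mem hv)).count_eq u).symm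
        _ ≤ _ := Finset.sum_le_sum_of_subset Finset.subset_union_right
    · intro h
      exact hN N le_rfl (h ▸ Finset.mem_insert_self _ _)
  · intro w hw
    have hstep : ∀ i, ω (i + 1) ∈ stk (ω 0) (pre (T (ω i)) ω) (ω i) := by
      intro i
      rw [← List.count_pos_iff, count_stk_pre, Finset.card_pos]
      refine ⟨i, ?_⟩
      simp only [Finset.mem_filter, Finset.mem_range, and_self, and_true]
      by_contra h
      exact hT (ω i) i (by omega) rfl
    have hpath : ∀ i, Relation.ReflTransGen
        (fun a b => b ∈ stk (ω 0) (pre (T a) ω) a) (ω 0) (ω i) := by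
      intro i
      induction i with
      | zero => exact Relation.ReflTransGen.refl
      | succ i ih => exact ih.tail (hstep i)
    obtain ⟨v, hv⟩ := List.exists_mem_of_ne_nil _ hw
    rw [← List.count_pos_iff, count_stk_pre, Finset.card_pos] at hv
    obtain ⟨i, hi⟩ := hv
    rw [← (Finset.mem_filter.1 hi).2.1]
    exact hpath i

end paths

section meas
variable [Countable S] [MeasurableSpace S] [DiscreteMeasurableSpace S]

lemma meas_pre (n : ℕ) (D : Set (List S)) : MeasurableSet (pre n ⁻¹' D) := by
  rw [← Set.biUnion_preimage_singleton]
  refine MeasurableSet.biUnion (Set.to_countable D) fun l _ => ?_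
  by_cases h : ∃ x, pre n x = l
  · obtain ⟨x, rfl⟩ := h
    have : pre n ⁻¹' {pre n x} = ⋂ i ∈ Finset.range n, (fun ω : ℕ → S => ω (i + 1)) ⁻¹' {x (i + 1)} := by
      ext ω
      simp [pre_eq_iff]
    rw [this]
    exact Finset.measurableSet_biInter _ fun i _ =>
      (measurable_pi_apply (i + 1)) (MeasurableSet.singleton _)
  · have : pre n ⁻¹' {l} = ∅ := by
      ext ω
      simp only [Set.mem_preimage, Set.mem_singleton_iff, Set.mem_empty_iff_false, iff_false]
      exact fun h' => h ⟨ω, h'⟩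
    rw [this]
    exact MeasurableSet.empty

variable [DecidableEq S]

lemma pe_pre {μ : Measure (ℕ → S)} (hPE : PartiallyExchangeable μ) {s0 : S}
    (h0 : ∀ᵐ ω ∂μ, ω 0 = s0) {n : ℕ} {l l' : List S} (hl : l.length = n) (hl' : l'.length = n)
    (hp : ∀ v, (stk s0 l' v).Perm (stk s0 l v)) : μ (pre n ⁻¹' {l}) = μ (pre n ⁻¹' {l'}) := by
  have key : ∀ x : ℕ → S, x 0 = s0 → μ (pre n ⁻¹' {pre n x}) = μ {ω | ∀ i ≤ n, ω i = x i} := by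
    intro x hx
    refine measure_congr ?_
    filter_upwards [h0] with ω hω
    have : ω ∈ pre n ⁻¹' {pre n x} ↔ ω ∈ {ω : ℕ → S | ∀ i ≤ n, ω i = x i} := by
      rw [Set.mem_ofPred_eq, cyl_iff, hω, hx]
      simp
    exact propext this
  obtain ⟨x, hx0, hx⟩ := exists_seq s0 l
  obtain ⟨y, hy0, hy⟩ := exists_seq s0 l'
  rw [hl] at hx
  rw [hl'] at hy
  rw [← hx, ← hy, key x hx0, key y hy0]
  refine hPE n x y ⟨hx0.trans hy0.symm, fun u v => ?_⟩
  rw [transCount_eq, transCount_eq, hx, hy, hx0, hy0]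
  exact ((hp u).count_eq v).symm

/-- Paths with protected set `K` and prescribed stacks on `K`. -/
def Wt (B : S → List S) (Q : Finset S) (s0 : S) (N : ℕ) (K : Finset S) (τ : ↥K → List S) :
    Set (List S) :=
  {l | l.length = N ∧ IsK B Q s0 l K ∧ ∀ v : ↥K, stk s0 l v.1 = τ v}

lemma Wt_le {μ : Measure (ℕ → S)} (hPE : PartiallyExchangeable μ) {s0 : S}
    (h0 : ∀ᵐ ω ∂μ, ω 0 = s0) (B : S → List S) (Q : Finset S) (N : ℕ) (K : Finset S)
    (τ τ' : ↥K → List S) (hτ : ∀ v, (τ' v).Perm (B v.1)) (hac : Acyc K τ') :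
    μ (pre N ⁻¹' Wt B Q s0 N K τ) ≤ μ (pre N ⁻¹' Wt B Q s0 N K τ') := by
  rw [← tsum_measure_preimage_singleton (Set.to_countable _) (fun y _ => meas_pre N {y}),
    ← tsum_measure_preimage_singleton (Set.to_countable _) (fun y _ => meas_pre N {y})]
  have hsw := fun l : Wt B Q s0 N K τ => switch l.2.2.1 τ' hτ hac
  choose f h1 h2 h3 h4 h5 using hsw
  have hf : ∀ l, f l ∈ Wt B Q s0 N K τ' := fun l => ⟨(h1 l).trans l.2.1, h5 l, h4 l⟩
  let g : Wt B Q s0 N K τ → Wt B Q s0 N K τ' := fun l => ⟨f l, hf l⟩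
  have hg : Function.Injective g := by
    intro l m hlm
    have hlm' : f l = f m := congrArg Subtype.val hlm
    refine Subtype.ext (stk_inj s0 _ _ fun v => ?_)
    by_cases hv : v ∈ K
    · exact (l.2.2.2 ⟨v, hv⟩).trans (m.2.2.2 ⟨v, hv⟩).symm
    · rw [← h3 l v hv, ← h3 m v hv, hlm']
  calc ∑' l : Wt B Q s0 N K τ, μ (pre N ⁻¹' {l.1})
      = ∑' l : Wt B Q s0 N K τ, μ (pre N ⁻¹' {(g l).1}) :=
        tsum_congr fun l => pe_pre hPE h0 l.2.1 (hf l).1 (h2 l)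
    _ ≤ _ := ENNReal.tsum_comp_le_tsum_of_injective hg (fun l => μ (pre N ⁻¹' {l.1}))

lemma mem_Conf {A : S → Finset (List S)} {K : Finset S} {τ : ↥K → List S} :
    τ ∈ Conf A K ↔ (∀ v, τ v ∈ A v.1) ∧ Acyc K τ := by
  simp [Conf]

lemma W_card {μ : Measure (ℕ → S)} (hPE : PartiallyExchangeable μ) {s0 : S}
    (h0 : ∀ᵐ ω ∂μ, ω 0 = s0) (B : S → List S) (Q : Finset S) (N : ℕ) (K : Finset S) :
    ∃ c, ∀ C ⊆ Conf (Lst B) K,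
      μ (pre N ⁻¹' ⋃ τ ∈ C, Wt B Q s0 N K τ) = C.card * c := by
  by_cases hne : (Conf (Lst B) K).Nonempty
  · obtain ⟨τ0, hτ0⟩ := hne
    refine ⟨μ (pre N ⁻¹' Wt B Q s0 N K τ0), fun C hC => ?_⟩
    have hP : ∀ τ ∈ Conf (Lst B) K, (∀ v, (τ v).Perm (B v.1)) ∧ Acyc K τ := fun τ hτ =>
      ⟨fun v => mem_Lst.1 ((mem_Conf.1 hτ).1 v), (mem_Conf.1 hτ).2⟩
    rw [Set.preimage_iUnion₂, measure_biUnion_finset]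
    · rw [Finset.sum_congr rfl fun τ hτ => le_antisymm
        (Wt_le hPE h0 B Q N K τ τ0 (hP τ0 hτ0).1 (hP τ0 hτ0).2)
        (Wt_le hPE h0 B Q N K τ0 τ (hP τ (hC hτ)).1 (hP τ (hC hτ)).2)]
      rw [Finset.sum_const, nsmul_eq_mul]
    · intro τ _ τ' _ hne
      refine Disjoint.preimage _ ?_
      rw [Set.disjoint_left]
      intro l hl hl'
      exact hne (funext fun v => (hl.2.2 v).symm.trans (hl'.2.2 v))
    · exact fun τ _ => meas_pre N _
  · refine ⟨0, fun C hC => ?_⟩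
    rw [Finset.not_nonempty_iff_eq_empty] at hne
    rw [hne, Finset.subset_empty] at hC
    subst hC
    simp

/-- Paths with protected set `K`. -/
def WK (B : S → List S) (Q : Finset S) (s0 : S) (N : ℕ) (K : Finset S) : Set (List S) :=
  {l | l.length = N ∧ IsK B Q s0 l K}

/-- Arrangements extending the stack of a given finite path. -/
def Ax (B : S → List S) (s0 : S) (lx : List S) (v : S) : Finset (List S) :=
  (Lst B v).filter (fun l => stk s0 lx v <+: l)

lemma Ax_eq (B : S → List S) (s0 : S) (lx : List S) (v : S) (hv : v ∉ (s0 :: lx).toFinset) :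
    Ax B s0 lx v = Lst B v := by
  have : stk s0 lx v = [] := by
    by_contra h
    exact hv (List.mem_toFinset.2 (stk_ne_nil_mem _ _ _ h))
  simp [Ax, this]

lemma WK_eq (B : S → List S) (Q : Finset S) (s0 : S) (N : ℕ) (K : Finset S) :
    WK B Q s0 N K = ⋃ τ ∈ Conf (Lst B) K, Wt B Q s0 N K τ := by
  ext l
  simp only [WK, Wt, Set.mem_iUnion, Set.mem_ofPred_eq, exists_prop]
  constructor
  · rintro ⟨h1, h2⟩
    exact ⟨fun v => stk s0 l v.1, mem_Conf.2 ⟨fun v => mem_Lst.2 (isK_perm h2 v.2).2, isK_acyc h2⟩,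
      h1, h2, fun _ => rfl⟩
  · rintro ⟨τ, _, h1, h2, _⟩
    exact ⟨h1, h2⟩

lemma WK_inter_eq (B : S → List S) (Q : Finset S) (s0 : S) (N : ℕ) (K : Finset S) (lx : List S)
    (hK : (s0 :: lx).toFinset ⊆ K) :
    WK B Q s0 N K ∩ {l | lx <+: l} = ⋃ τ ∈ Conf (Ax B s0 lx) K, Wt B Q s0 N K τ := by
  ext l
  simp only [WK, Wt, Set.mem_iUnion, Set.mem_ofPred_eq, exists_prop, Set.mem_inter_iff]
  constructor
  · rintro ⟨⟨h1, h2⟩, h3⟩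
    refine ⟨fun v => stk s0 l v.1, mem_Conf.2 ⟨fun v => ?_, isK_acyc h2⟩, h1, h2, fun _ => rfl⟩
    exact Finset.mem_filter.2 ⟨mem_Lst.2 (isK_perm h2 v.2).2, (stk_prefix s0 lx l).1 h3 v.1⟩
  · rintro ⟨τ, hτ, h1, h2, h3⟩
    refine ⟨⟨h1, h2⟩, (stk_prefix s0 lx l).2 fun v => ?_⟩
    by_cases hv : v ∈ K
    · have := (Finset.mem_filter.1 ((mem_Conf.1 hτ).1 ⟨v, hv⟩)).2
      rw [← h3 ⟨v, hv⟩] at this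
      exact this
    · have : stk s0 lx v = [] := by
        by_contra h
        exact hv (hK (List.mem_toFinset.2 (stk_ne_nil_mem _ _ _ h)))
      rw [this]
      exact List.nil_prefix

lemma W_ratio {μ : Measure (ℕ → S)} (hPE : PartiallyExchangeable μ) {s0 : S}
    (h0 : ∀ᵐ ω ∂μ, ω 0 = s0) {B : S → List S} (hB : Good B s0) (Q : Finset S) (N : ℕ)
    (K : Finset S) (lx : List S) (hK : (s0 :: lx).toFinset ⊆ K) :
    μ (pre N ⁻¹' (WK B Q s0 N K ∩ {l | lx <+: l})) =
      ENNReal.ofReal (((Conf (Ax B s0 lx) K).card : ℝ) / ((Conf (Lst B) K).card : ℝ)) *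
        μ (pre N ⁻¹' WK B Q s0 N K) := by
  obtain ⟨c, hc⟩ := W_card hPE h0 B Q N K
  have hsub : Conf (Ax B s0 lx) K ⊆ Conf (Lst B) K := by
    intro τ hτ
    rw [mem_Conf] at hτ ⊢
    exact ⟨fun v => Finset.filter_subset _ _ (hτ.1 v), hτ.2⟩
  rw [WK_inter_eq _ _ _ _ _ _ hK, WK_eq, hc _ hsub, hc _ (Finset.Subset.refl _)]
  have hne := Conf_card_ne hB K
  have hpos : (0 : ℝ) < (Conf (Lst B) K).card := lt_of_le_of_ne (Nat.cast_nonneg _) hne.symm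
  rw [← mul_assoc, ENNReal.ofReal_div_of_pos hpos, ENNReal.ofReal_natCast, ENNReal.ofReal_natCast,
    ENNReal.div_mul_cancel]
  · exact_mod_cast hne
  · exact ENNReal.natCast_ne_top _

/-- The event that the protected set contains `Q`. -/
def EN (B : S → List S) (Q : Finset S) (s0 : S) (N : ℕ) : Set (List S) :=
  {l | l.length = N ∧ ∃ K, IsK B Q s0 l K ∧ Q ⊆ K}

lemma EN_eq (B : S → List S) (Q : Finset S) (s0 : S) (N : ℕ) :
    EN B Q s0 N = ⋃ K : {K : Finset S // Q ⊆ K}, WK B Q s0 N K.1 := by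
  ext l
  simp only [EN, WK, Set.mem_iUnion, Set.mem_ofPred_eq]
  constructor
  · rintro ⟨h1, K, h2, h3⟩
    exact ⟨⟨K, h3⟩, h1, h2⟩
  · rintro ⟨⟨K, h3⟩, h1, h2⟩
    exact ⟨h1, K, h2, h3⟩

lemma WK_disj (B : S → List S) (Q : Finset S) (s0 : S) (N : ℕ) :
    Pairwise (Function.onFun Disjoint fun K : {K : Finset S // Q ⊆ K} => WK B Q s0 N K.1) := by
  intro K K' hne
  rw [Function.onFun, Set.disjoint_left]
  intro l hl hl'
  exact hne (Subtype.ext (isK_unique hl.2 hl'.2))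

lemma EN_tsum (μ : Measure (ℕ → S)) (B : S → List S) (Q : Finset S) (s0 : S) (N : ℕ)
    (D : Set (List S)) :
    μ (pre N ⁻¹' (EN B Q s0 N ∩ D)) =
      ∑' K : {K : Finset S // Q ⊆ K}, μ (pre N ⁻¹' (WK B Q s0 N K.1 ∩ D)) := by
  rw [EN_eq, Set.iUnion_inter, Set.preimage_iUnion, measure_iUnion]
  · intro K K' hne
    exact Disjoint.preimage _ ((WK_disj B Q s0 N hne).mono Set.inter_subset_left
      Set.inter_subset_left)
  · exact fun K => meas_pre N _

lemma EN_bounds {μ : Measure (ℕ → S)} (hPE : PartiallyExchangeable μ) {s0 : S}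
    (h0 : ∀ᵐ ω ∂μ, ω 0 = s0) {B : S → List S} (hB : Good B s0) (Q : Finset S) (N : ℕ)
    (lx : List S) (hQ : (s0 :: lx).toFinset ⊆ Q) (a b : ℝ)
    (hab : ∀ K, Q ⊆ K → a ≤ ((Conf (Ax B s0 lx) K).card : ℝ) / ((Conf (Lst B) K).card : ℝ) ∧
      ((Conf (Ax B s0 lx) K).card : ℝ) / ((Conf (Lst B) K).card : ℝ) ≤ b) :
    ENNReal.ofReal a * μ (pre N ⁻¹' EN B Q s0 N) ≤ μ (pre N ⁻¹' (EN B Q s0 N ∩ {l | lx <+: l})) ∧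
    μ (pre N ⁻¹' (EN B Q s0 N ∩ {l | lx <+: l})) ≤ ENNReal.ofReal b * μ (pre N ⁻¹' EN B Q s0 N) := by
  have h1 := EN_tsum μ B Q s0 N Set.univ
  simp only [Set.inter_univ] at h1
  rw [h1, EN_tsum, ← ENNReal.tsum_mul_left, ← ENNReal.tsum_mul_left]
  constructor
  · refine ENNReal.tsum_le_tsum fun K => ?_
    rw [W_ratio hPE h0 hB Q N K.1 lx (hQ.trans K.2)]
    gcongr
    exact (hab K.1 K.2).1
  · refine ENNReal.tsum_le_tsum fun K => ?_
    rw [W_ratio hPE h0 hB Q N K.1 lx (hQ.trans K.2)]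
    gcongr
    exact (hab K.1 K.2).2

lemma pre_eq_iff_prefix {N : ℕ} (lx : List S) (h : lx.length ≤ N) (ω : ℕ → S) :
    pre lx.length ω = lx ↔ lx <+: pre N ω := by
  constructor
  · intro h'
    have := pre_prefix h ω
    rwa [h'] at this
  · intro h'
    exact (List.prefix_of_prefix_length_le (pre_prefix h ω) h' (by rw [pre_length])).eq_of_length
      (pre_length _ _)

lemma cyl_val {s0 : S} {B : S → List S} (hB : Good B s0) (lx : List S) :
    ∃ q : ℝ, ∀ μ : Measure (ℕ → S), IsProbabilityMeasure μ → PartiallyExchangeable μ →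
      (∀ᵐ ω ∂μ, ω 0 = s0) → (∀ᵐ ω ∂μ, ∀ s, {i : ℕ | ω i = s}.Finite) →
      (∀ᵐ ω ∂μ, ∀ u v, transNum ω u v = ((B u).count v : ℕ∞)) →
      μ (pre lx.length ⁻¹' {lx}) = ENNReal.ofReal q := by
  obtain ⟨q, hq⟩ := ratio_lim hB (Ax B s0 lx) (s0 :: lx).toFinset (Ax_eq B s0 lx)
  refine ⟨q, fun μ hμ hPE h0 ht hM => ?_⟩
  have key : ∀ ε > 0, ENNReal.ofReal (q - ε) ≤ μ (pre lx.length ⁻¹' {lx}) ∧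
      μ (pre lx.length ⁻¹' {lx}) ≤ ENNReal.ofReal (q + ε) := by
    intro ε hε
    have hev := hq.eventually (Icc_mem_nhds (show q - ε < q by linarith)
      (show q < q + ε by linarith))
    obtain ⟨Q0, hQ0⟩ := eventually_atTop.1 hev
    set Q := Q0 ∪ (s0 :: lx).toFinset
    have hb := fun N => EN_bounds hPE h0 hB Q N lx Finset.subset_union_right (q - ε) (q + ε)
      (fun K hK => hQ0 K (Finset.subset_union_left.trans hK))
    have hE : ∀ᵐ ω ∂μ, ∀ᶠ N in atTop, pre N ω ∈ EN B Q s0 N := by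
      filter_upwards [h0, ht, hM] with ω hω0 hωt hωM
      filter_upwards [ev_isK hωt hωM Q] with N hN
      rw [hω0] at hN
      obtain ⟨K, hK⟩ := exists_isK B Q s0 (pre N ω)
      exact ⟨pre_length _ _, K, hK, hN K hK⟩
    have l1 : Tendsto (fun N => μ (pre N ⁻¹' EN B Q s0 N)) atTop (𝓝 1) := by
      rw [← measure_univ (μ := μ)]
      refine tendsto_measure_of_ae_tendsto_indicator_of_isFiniteMeasure atTop MeasurableSet.univ
        (fun N => meas_pre N _) ?_
      filter_upwards [hE] with ω hω
      filter_upwards [hω] with N hN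
      simpa using hN
    have l2 : Tendsto (fun N => μ (pre N ⁻¹' (EN B Q s0 N ∩ {l | lx <+: l}))) atTop
        (𝓝 (μ (pre lx.length ⁻¹' {lx}))) := by
      refine tendsto_measure_of_ae_tendsto_indicator_of_isFiniteMeasure atTop (meas_pre _ _)
        (fun N => meas_pre N _) ?_
      filter_upwards [hE] with ω hω
      filter_upwards [hω, eventually_ge_atTop lx.length] with N hN hle
      simp only [Set.mem_preimage, Set.mem_inter_iff, hN, true_and, Set.mem_singleton_iff,
        Set.mem_ofPred_eq]
      exact (pre_eq_iff_prefix lx hle ω).symm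
    constructor
    · have := ENNReal.Tendsto.const_mul (a := ENNReal.ofReal (q - ε)) l1 (Or.inl one_ne_zero)
      rw [mul_one] at this
      exact le_of_tendsto_of_tendsto' this l2 fun N => (hb N).1
    · have := ENNReal.Tendsto.const_mul (a := ENNReal.ofReal (q + ε)) l1 (Or.inl one_ne_zero)
      rw [mul_one] at this
      exact le_of_tendsto_of_tendsto' l2 this fun N => (hb N).2
  have t1 : Tendsto (fun ε : ℝ => ENNReal.ofReal (q - ε)) (𝓝[>] 0) (𝓝 (ENNReal.ofReal q)) := by
    have : Tendsto (fun ε : ℝ => ENNReal.ofReal (q - ε)) (𝓝 0) (𝓝 (ENNReal.ofReal (q - 0))) :=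
      (ENNReal.continuous_ofReal.comp (continuous_const.sub continuous_id)).tendsto 0
    rw [sub_zero] at this
    exact this.mono_left nhdsWithin_le_nhds
  have t2 : Tendsto (fun ε : ℝ => ENNReal.ofReal (q + ε)) (𝓝[>] 0) (𝓝 (ENNReal.ofReal q)) := by
    have : Tendsto (fun ε : ℝ => ENNReal.ofReal (q + ε)) (𝓝 0) (𝓝 (ENNReal.ofReal (q + 0))) :=
      (ENNReal.continuous_ofReal.comp (continuous_const.add continuous_id)).tendsto 0
    rw [add_zero] at this
    exact this.mono_left nhdsWithin_le_nhds
  refine le_antisymm ?_ ?_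
  · exact ge_of_tendsto t2 (eventually_nhdsWithin_of_forall fun ε hε => (key ε hε).2)
  · exact le_of_tendsto t1 (eventually_nhdsWithin_of_forall fun ε hε => (key ε hε).1)

end meas

section final
variable [Countable S] [MeasurableSpace S] [DiscreteMeasurableSpace S]

lemma meas_coord (i : ℕ) (s : S) : MeasurableSet {x : ℕ → S | x i = s} := by
  have h : Measurable (fun x : ℕ → S => x i) := measurable_pi_apply i
  exact h (MeasurableSet.singleton s)

lemma meas_trans : MeasurableSet {x : ℕ → S | ∀ s : S, {i : ℕ | x i = s}.Finite} := by
  have : {x : ℕ → S | ∀ s : S, {i : ℕ | x i = s}.Finite}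
      = ⋂ s : S, ⋃ T : ℕ, ⋂ j : {j : ℕ // T ≤ j}, {x : ℕ → S | x j.1 = s}ᶜ := by
    ext x
    simp only [Set.mem_ofPred_eq, Set.mem_iInter, Set.mem_iUnion, Set.mem_compl_iff]
    refine forall_congr' fun s => ⟨fun h => ?_, ?_⟩
    · obtain ⟨T, hT⟩ := h.bddAbove
      refine ⟨T + 1, fun j hj => ?_⟩
      have := hT hj
      have := j.2
      omega
    · rintro ⟨T, hT⟩
      refine (Set.finite_lt_nat T).subset fun j hj => ?_
      by_contra h
      exact hT ⟨j, not_lt.1 h⟩ hj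
  rw [this]
  exact MeasurableSet.iInter fun s => MeasurableSet.iUnion fun T => MeasurableSet.iInter fun j =>
    (meas_coord j.1 s).compl

lemma meas_transNum_ge (u v : S) (n : ℕ) :
    MeasurableSet {x : ℕ → S | (n : ℕ∞) ≤ transNum x u v} := by
  have : {x : ℕ → S | (n : ℕ∞) ≤ transNum x u v}
      = ⋃ F : {F : Finset ℕ // F.card = n}, ⋂ i : ↥F.1,
        ({x : ℕ → S | x i.1 = u} ∩ {x : ℕ → S | x (i.1 + 1) = v}) := by
    ext x
    simp only [Set.mem_ofPred_eq, Set.mem_iInter, Set.mem_iUnion, Set.mem_inter_iff]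
    constructor
    · intro h
      obtain ⟨t, hts, ht⟩ := Set.exists_subset_encard_eq h
      have hfin : t.Finite := Set.finite_of_encard_eq_coe ht
      refine ⟨⟨hfin.toFinset, ?_⟩, fun i => hts (hfin.mem_toFinset.1 i.2)⟩
      rw [hfin.encard_eq_coe_toFinset_card] at ht
      exact_mod_cast ht
    · rintro ⟨⟨F, hF⟩, h⟩
      rw [← hF, ← Set.encard_coe_eq_coe_finsetCard]
      exact Set.encard_le_encard fun i hi => h ⟨i, hi⟩
  rw [this]
  exact MeasurableSet.iUnion fun F => MeasurableSet.iInter fun i =>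
    (meas_coord _ _).inter (meas_coord _ _)

lemma meas_M (M : S → S → ℕ∞) : MeasurableSet {x : ℕ → S | ∀ u v : S, transNum x u v = M u v} := by
  have : {x : ℕ → S | ∀ u v : S, transNum x u v = M u v}
      = ⋂ u : S, ⋂ v : S, ⋂ n : ℕ, {x | (n : ℕ∞) ≤ transNum x u v ↔ (n : ℕ∞) ≤ M u v} := by
    ext x
    simp only [Set.mem_ofPred_eq, Set.mem_iInter]
    refine forall_congr' fun u => forall_congr' fun v => ⟨fun h n => by rw [h], fun h => ?_⟩
    exact ENat.eq_of_forall_natCast_le_iff h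
  rw [this]
  refine MeasurableSet.iInter fun u => MeasurableSet.iInter fun v => MeasurableSet.iInter fun n => ?_
  by_cases h : (n : ℕ∞) ≤ M u v
  · simpa [h] using meas_transNum_ge u v n
  · have := (meas_transNum_ge u v n).compl
    simp only [h, iff_false]
    exact this

lemma ae_of_one {μ : Measure (ℕ → S)} [IsProbabilityMeasure μ] {p : (ℕ → S) → Prop}
    (hm : MeasurableSet {x | p x}) (h : μ {x | p x} = 1) : ∀ᵐ x ∂μ, p x :=
  (prob_compl_eq_zero_iff hm).2 h

lemma pre_take {n m : ℕ} (h : n ≤ m) (ω : ℕ → S) : (pre m ω).take n = pre n ω := by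
  have := List.prefix_iff_eq_take.1 (pre_prefix h ω)
  rw [pre_length] at this
  exact this.symm

lemma ext_cyl {μ ν : Measure (ℕ → S)} [IsProbabilityMeasure μ] [IsProbabilityMeasure ν] {s0 : S}
    (h0 : ∀ᵐ ω ∂μ, ω 0 = s0) (h0' : ∀ᵐ ω ∂ν, ω 0 = s0)
    (h : ∀ l : List S, μ (pre l.length ⁻¹' {l}) = ν (pre l.length ⁻¹' {l})) : μ = ν := by
  let f : ℕ → (ℕ → S) → S × List S := fun n ω => (ω 0, pre n ω)
  have hm : ∀ n D, MeasurableSet (f n ⁻¹' D) := by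
    intro n D
    have : f n ⁻¹' D = ⋃ s : S, ({ω | ω 0 = s} ∩ pre n ⁻¹' {l | (s, l) ∈ D}) := by
      ext ω
      simp [f]
    rw [this]
    exact MeasurableSet.iUnion fun s => (meas_coord 0 s).inter (meas_pre n _)
  refine ext_of_generate_finite {A | ∃ n D, A = f n ⁻¹' D} ?_ ?_ ?_ (by simp)
  · apply le_antisymm
    · refine iSup_le fun i => ?_
      rw [MeasurableSpace.comap_le_iff_le_map]
      intro A _
      refine MeasurableSpace.measurableSet_generateFrom ⟨i, {p | endp p.1 p.2 ∈ A}, ?_⟩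
      ext ω
      simp [f, endp_pre]
    · refine MeasurableSpace.generateFrom_le ?_
      rintro _ ⟨n, D, rfl⟩
      exact hm n D
  · rintro _ ⟨n, D, rfl⟩ _ ⟨m, D', rfl⟩ _
    refine ⟨max n m, {p | (p.1, p.2.take n) ∈ D ∧ (p.1, p.2.take m) ∈ D'}, ?_⟩
    ext ω
    simp [f, pre_take]
  · rintro _ ⟨n, D, rfl⟩
    have key : ∀ ρ : Measure (ℕ → S), (∀ᵐ ω ∂ρ, ω 0 = s0) →
        ρ (f n ⁻¹' D) = ∑' l : {l | (s0, l) ∈ D}, ρ (pre n ⁻¹' {l.1}) := by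
      intro ρ hρ
      rw [tsum_measure_preimage_singleton (Set.to_countable _) (fun y _ => meas_pre n {y})]
      refine measure_congr ?_
      filter_upwards [hρ] with ω hω
      have : ω ∈ f n ⁻¹' D ↔ ω ∈ pre n ⁻¹' {l | (s0, l) ∈ D} := by
        simp [f, hω]
      exact propext this
    rw [key μ h0, key ν h0']
    refine tsum_congr fun l => ?_
    by_cases hl : l.1.length = n
    · subst hl
      exact h l.1
    · have : pre n ⁻¹' {l.1} = ∅ := by
        ext ω
        simp only [Set.mem_preimage, Set.mem_singleton_iff, Set.mem_empty_iff_false, iff_false]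
        intro h'
        exact hl (by rw [← h', pre_length])
      rw [this, measure_empty, measure_empty]

end final

end helpers

/-- Given an initial state `s0` and prescribed transition numbers `M`, there is
at most one transient partially exchangeable probability measure on `S^ℕ` with initial state `s0`
and transition numbers `M` almost surely. -/
theorem stmt3 {S : Type} [Countable S] [MeasurableSpace S] [DiscreteMeasurableSpace S]
    (s0 : S) (M : S → S → ℕ∞) (μ ν : Measure (ℕ → S))
    (hμprob : μ Set.univ = 1) (hμPE : PartiallyExchangeable μ)
    (hμtrans : μ {x | ∀ s : S, {i : ℕ | x i = s}.Finite} = 1)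
    (hμ0 : μ {x | x 0 = s0} = 1)
    (hμM : μ {x | ∀ u v : S, transNum x u v = M u v} = 1)
    (hνprob : ν Set.univ = 1) (hνPE : PartiallyExchangeable ν)
    (hνtrans : ν {x | ∀ s : S, {i : ℕ | x i = s}.Finite} = 1)
    (hν0 : ν {x | x 0 = s0} = 1)
    (hνM : ν {x | ∀ u v : S, transNum x u v = M u v} = 1) :
    μ = ν := by
  classical
  have hμp : IsProbabilityMeasure μ := ⟨hμprob⟩
  have hνp : IsProbabilityMeasure ν := ⟨hνprob⟩
  have a1 := ae_of_one meas_trans hμtrans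
  have a2 := ae_of_one (meas_coord 0 s0) hμ0
  have a3 := ae_of_one (meas_M M) hμM
  have b1 := ae_of_one meas_trans hνtrans
  have b2 := ae_of_one (meas_coord 0 s0) hν0
  have b3 := ae_of_one (meas_M M) hνM
  obtain ⟨ω, h1, h2, h3⟩ := (a1.and (a2.and a3)).exists
  obtain ⟨B, hBM, hB⟩ := exists_B h1
  rw [h2] at hB
  have hM : ∀ u v, M u v = ((B u).count v : ℕ∞) := fun u v => (h3 u v).symm.trans (hBM u v)
  refine ext_cyl a2 b2 fun l => ?_
  obtain ⟨q, hq⟩ := cyl_val hB l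
  rw [hq μ hμp hμPE a2 a1 (a3.mono fun x hx u v => (hx u v).trans (hM u v)),
    hq ν hνp hνPE b2 b1 (b3.mono fun x hx u v => (hx u v).trans (hM u v))]

end DF
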